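/- For every δ > 0 there exist ε > 0 and n₀ ∈ ℕ such that for every p ∈ (0,1] and every n ≥ n₀ the following holds. Every (p,λ)-bijumbled graph G on n vertices with λ ≤ ε p² n / log n and minimum degree δ(G) ≥ δ p n is 2-universal: G contains a copy of every graph H on at most n vertices with maximum degree Δ(H) ≤ 2. -/

import Mathlib

open Finset

/-- The number of pairs `(a,b) ∈ A × B` with `ab` an edge of `G`
(edges inside `A ∩ B` are counted twice). -/
def ePairs {V : Type} [DecidableEq V] (G : SimpleGraph V) [DecidableRel G.Adj]
    (A B : Finset V) : ℕ :=
  ((A ×ˢ B).filter fun ab => G.Adj ab.1 ab.2).card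

/-- `G` is `(p,λ)`-bijumbled: `|e(A,B) − p|A||B|| < λ√(|A||B|)` for all (nonempty)
vertex subsets `A, B`. -/
def Bijumbled {V : Type} [Fintype V] [DecidableEq V] (G : SimpleGraph V)
    [DecidableRel G.Adj] (p lam : ℝ) : Prop :=
  ∀ A B : Finset V, A.Nonempty → B.Nonempty →
    |(ePairs G A B : ℝ) - p * A.card * B.card| < lam * Real.sqrt (A.card * B.card)

set_option linter.unusedSectionVars false

section Basics

variable {V : Type} [Fintype V] [DecidableEq V] (G : SimpleGraph V) [DecidableRel G.Adj]

/-- The neighbours of `v` inside `A`. -/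
def nbrIn (v : V) (A : Finset V) : Finset V := A.filter fun w => G.Adj v w

variable {G}

lemma mem_nbrIn {v w : V} {A : Finset V} : w ∈ nbrIn G v A ↔ w ∈ A ∧ G.Adj v w := by
  simp [nbrIn]

lemma nbrIn_subset (v : V) (A : Finset V) : nbrIn G v A ⊆ A := filter_subset _ _

lemma ePairs_eq_sum (A B : Finset V) : ePairs G A B = ∑ a ∈ A, (nbrIn G a B).card := by
  unfold ePairs nbrIn
  rw [card_filter, sum_product]
  exact sum_congr rfl fun a _ => (card_filter _ _).symm

/-- Jumbledness with the error term written as `p * k`. -/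
lemma Bijumbled.scaled {p lam k : ℝ} (h : Bijumbled G p lam) (hk : lam ≤ p * k)
    (A B : Finset V) (hA : A.Nonempty) (hB : B.Nonempty) :
    |(ePairs G A B : ℝ) - p * A.card * B.card| < p * k * Real.sqrt (A.card * B.card) :=
  (h A B hA hB).trans_le (mul_le_mul_of_nonneg_right hk (Real.sqrt_nonneg _))

/-- If the number of pairs between `S` and `B` is off by a constant proportion of its expectation,
then `|S||B|` is small. -/
lemma Bijumbled.card_mul_card_le {p lam k t : ℝ} (hp : 0 < p) (h : Bijumbled G p lam)
    (hk : lam ≤ p * k) (ht : 0 < t) (S B : Finset V)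
    (hdev : t * (p * S.card * B.card) ≤ |(ePairs G S B : ℝ) - p * S.card * B.card|) :
    t ^ 2 * ((S.card : ℝ) * B.card) ≤ k ^ 2 := by
  rcases S.eq_empty_or_nonempty with rfl | hS
  · simpa using sq_nonneg k
  rcases B.eq_empty_or_nonempty with rfl | hB
  · simpa using sq_nonneg k
  have h1 := h.scaled hk S B hS hB
  have hs : (0 : ℝ) < S.card := by exact_mod_cast hS.card_pos
  have hb : (0 : ℝ) < B.card := by exact_mod_cast hB.card_pos
  set q : ℝ := (S.card : ℝ) * B.card with hq
  have hq0 : 0 < q := mul_pos hs hb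
  have hsq : Real.sqrt q * Real.sqrt q = q := Real.mul_self_sqrt hq0.le
  have hr : 0 < Real.sqrt q := Real.sqrt_pos.mpr hq0
  have h2 : t * (p * q) < p * k * Real.sqrt q := by
    have : t * (p * S.card * B.card) = t * (p * q) := by rw [hq]; ring
    linarith
  have h3 : t * Real.sqrt q < k := by
    have h4 : (p * Real.sqrt q) * (t * Real.sqrt q) < (p * Real.sqrt q) * k := by
      calc (p * Real.sqrt q) * (t * Real.sqrt q) = t * (p * (Real.sqrt q * Real.sqrt q)) := by ring
        _ = t * (p * q) := by rw [hsq]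
        _ < p * k * Real.sqrt q := h2
        _ = _ := by ring
    exact lt_of_mul_lt_mul_left h4 (by positivity)
  calc t ^ 2 * q = (t * Real.sqrt q) ^ 2 := by rw [mul_pow, sq (Real.sqrt q), hsq]
    _ ≤ k ^ 2 := by gcongr

lemma Bijumbled.no_edges {p lam k : ℝ} (hp : 0 < p) (h : Bijumbled G p lam)
    (hk : lam ≤ p * k) (S B : Finset V) (hno : ∀ a ∈ S, ∀ b ∈ B, ¬ G.Adj a b) :
    (S.card : ℝ) * B.card ≤ k ^ 2 := by
  have h0 : ePairs G S B = 0 := by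
    rw [ePairs_eq_sum]
    exact sum_eq_zero fun a ha =>
      card_eq_zero.mpr (filter_eq_empty_iff.mpr fun b hb => hno a ha b hb)
  have := h.card_mul_card_le hp hk one_pos S B (by
    rw [h0, Nat.cast_zero, zero_sub, abs_neg, one_mul]; exact le_abs_self _)
  simpa using this

lemma Bijumbled.low_degree {p lam k : ℝ} (hp : 0 < p) (h : Bijumbled G p lam)
    (hk : lam ≤ p * k) (S B : Finset V)
    (hlow : ∀ a ∈ S, ((nbrIn G a B).card : ℝ) ≤ p * B.card / 2) :
    (S.card : ℝ) * B.card ≤ 4 * k ^ 2 := by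
  have h0 : (ePairs G S B : ℝ) ≤ p * S.card * B.card / 2 := by
    rw [ePairs_eq_sum]; push_cast
    calc ∑ a ∈ S, ((nbrIn G a B).card : ℝ) ≤ ∑ a ∈ S, p * B.card / 2 := sum_le_sum hlow
      _ = _ := by rw [sum_const, nsmul_eq_mul]; ring
  have := h.card_mul_card_le hp hk (t := 1 / 2) (by norm_num) S B (by
    rw [abs_sub_comm]
    refine le_trans ?_ (le_abs_self _)
    linarith)
  nlinarith

/-- Few vertices have many neighbours in a small set. -/
lemma Bijumbled.high_degree {p lam k d : ℝ} (hp : 0 < p) (h : Bijumbled G p lam)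
    (hk : lam ≤ p * k) (S F : Finset V) (hd : 2 * F.card ≤ d)
    (hhigh : ∀ a ∈ S, p * d ≤ (nbrIn G a F).card) :
    (S.card : ℝ) * d ^ 2 ≤ 4 * k ^ 2 * F.card := by
  rcases F.eq_empty_or_nonempty with rfl | hF
  · rcases S.eq_empty_or_nonempty with rfl | ⟨a, ha⟩
    · simp
    · have h1 := hhigh a ha
      simp only [nbrIn, filter_empty, card_empty, Nat.cast_zero, mul_zero] at h1 hd ⊢
      have : d = 0 := le_antisymm (by nlinarith) hd
      rw [this, zero_pow two_ne_zero, mul_zero]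
  rcases S.eq_empty_or_nonempty with rfl | hS
  · simp only [card_empty, Nat.cast_zero, zero_mul]; positivity
  have hf : (0 : ℝ) < F.card := by exact_mod_cast hF.card_pos
  have hs : (0 : ℝ) < S.card := by exact_mod_cast hS.card_pos
  have h0 : p * S.card * d ≤ (ePairs G S F : ℝ) := by
    rw [ePairs_eq_sum]; push_cast
    calc p * S.card * d = ∑ a ∈ S, p * d := by rw [sum_const, nsmul_eq_mul]; ring
      _ ≤ _ := sum_le_sum hhigh
  obtain ⟨u, hud⟩ : ∃ u : ℝ, d = u * (2 * F.card) := ⟨d / (2 * F.card), by field_simp⟩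
  have hu1 : 1 ≤ u := by
    by_contra! hlt
    nlinarith
  have := h.card_mul_card_le hp hk (t := u) (by linarith) S F (by
    refine le_trans ?_ (le_abs_self _)
    have : p * S.card * F.card * 1 ≤ p * S.card * F.card * u :=
      mul_le_mul_of_nonneg_left hu1 (by positivity)
    rw [hud] at h0
    nlinarith)
  rw [hud]
  nlinarith

end Basics

section Closure

variable {α β : Type*} [DecidableEq α] [DecidableEq β]

/-- Hall's theorem relative to finite sets. -/
lemma exists_injOn_of_hall (r : β → α → Prop) [∀ b a, Decidable (r b a)] (J : Finset β)
    (X : Finset α) [Nonempty α]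
    (h : ∀ B ⊆ J, B.card ≤ (X.filter fun a => ∃ b ∈ B, r b a).card) :
    ∃ w : β → α, Set.InjOn w J ∧ ∀ b ∈ J, w b ∈ X ∧ r b (w b) := by
  have hall := (Finset.all_card_le_biUnion_card_iff_exists_injective
    (fun b : J => X.filter fun a => r b a)).mp (by
      intro S
      have h1 := h (S.map (Function.Embedding.subtype _)) (by
        intro b hb
        obtain ⟨c, -, rfl⟩ := mem_map.mp hb
        exact c.2)
      rw [card_map] at h1
      refine h1.trans (card_le_card ?_)
      intro a ha
      obtain ⟨haX, b, hb, hr⟩ := mem_filter.mp ha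
      obtain ⟨c, hc, rfl⟩ := mem_map.mp hb
      exact mem_biUnion.mpr ⟨c, hc, mem_filter.mpr ⟨haX, hr⟩⟩)
  obtain ⟨w, hw, hmem⟩ := hall
  classical
  refine ⟨fun b => if hb : b ∈ J then w ⟨b, hb⟩ else Classical.arbitrary α, ?_, ?_⟩
  · intro b hb c hc hbc
    simp only [mem_coe] at hb hc
    simp only [hb, hc, dif_pos] at hbc
    exact congrArg Subtype.val (hw hbc)
  · intro b hb
    simp only [hb, dif_pos]
    exact ⟨(mem_filter.mp (hmem ⟨b, hb⟩)).1, (mem_filter.mp (hmem ⟨b, hb⟩)).2⟩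

/-- If all pairs of large sets of slots and elements are joined by an incidence, then after
discarding few slots and few elements, all remaining slots can be filled injectively from any
large enough set of remaining elements that contains the remaining part of a flexible set. -/
lemma exists_robust_filling [Nonempty α] (r : β → α → Prop) [∀ b a, Decidable (r b a)]
    (J : Finset β) (V₀ X₁ : Finset α)
    (f : ℕ) (hJ : 6 * f ≤ J.card) (hX₁ : 6 * f ≤ X₁.card) (hXV : X₁ ⊆ V₀)
    (hL : ∀ A ⊆ V₀, f ≤ A.card → (J.filter fun b => ∀ a ∈ A, ¬ r b a).card < f) :
    ∃ D ⊆ J, ∃ F ⊆ V₀, D.card < f ∧ F.card < f ∧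
      ∀ X ⊆ V₀ \ F, X₁ \ F ⊆ X → (J \ D).card ≤ X.card →
        ∃ w : β → α, Set.InjOn w (J \ D : Finset β) ∧ ∀ b ∈ J \ D, w b ∈ X ∧ r b (w b) := by
  classical
  let nb : Finset α → Finset β := fun A => J.filter fun b => ∃ a ∈ A, r b a
  let nx : Finset β → Finset α := fun B => X₁.filter fun a => ∃ b ∈ B, r b a
  let good : Finset β × Finset α → Prop := fun q =>
    q.1.card ≤ 2 * f ∧ q.2.card ≤ 2 * f ∧ (nb q.2 \ q.1).card ≤ q.2.card ∧
      (nx q.1 \ q.2).card ≤ q.1.card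
  obtain ⟨⟨D, F⟩, hq, hmax⟩ := exists_max_image ((J.powerset ×ˢ V₀.powerset).filter good)
    (fun q => q.1.card + q.2.card) ⟨(∅, ∅), by simp [good, nb, nx]⟩
  obtain ⟨hDF, hD2, hF2, hFe, hDe⟩ := mem_filter.mp hq
  obtain ⟨hDJ, hFV⟩ := mem_product.mp hDF
  rw [mem_powerset] at hDJ hFV
  simp only at hD2 hF2 hFe hDe hDJ hFV
  have miss : ∀ A ⊆ V₀, f ≤ A.card → J.card < (nb A).card + f := by
    intro A hA hAf
    have h1 := hL A hA hAf
    have h2 : (nb A).card + (J.filter fun b => ∀ a ∈ A, ¬ r b a).card = J.card := by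
      rw [← card_filter_add_card_filter_not (s := J) (fun b => ∃ a ∈ A, r b a)]
      congr 2
      ext b; simp
    omega
  have hFf : F.card < f := by
    by_contra! hcon
    have h1 := miss F hFV hcon
    have h2 := le_card_sdiff D (nb F)
    omega
  have hDf : D.card < f := by
    by_contra! hcon
    have hA : (X₁ \ nx D).card < f := by
      by_contra! hA
      have h1 := hL _ (sdiff_subset.trans hXV) hA
      have h2 : D ⊆ J.filter fun b => ∀ a ∈ X₁ \ nx D, ¬ r b a := by
        intro b hb
        refine mem_filter.mpr ⟨hDJ hb, fun a ha hr => ?_⟩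
        obtain ⟨ha1, ha2⟩ := mem_sdiff.mp ha
        exact ha2 (mem_filter.mpr ⟨ha1, b, hb, hr⟩)
      have := card_le_card h2
      omega
    have h1 := le_card_sdiff (nx D) X₁
    have h2 := le_card_sdiff F (nx D)
    omega
  have expV : ∀ A ⊆ V₀ \ F, A.card ≤ f → A.card ≤ (nb A \ D).card := by
    intro A hA hAf
    by_contra! hlt
    have hdisj : Disjoint F A := disjoint_of_subset_right hA disjoint_sdiff
    have hAne : 0 < A.card := by omega
    have hcard := card_union_of_disjoint hdisj
    have hmem : (D, F ∪ A) ∈ (J.powerset ×ˢ V₀.powerset).filter good := by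
      refine mem_filter.mpr ⟨mem_product.mpr ⟨mem_powerset.mpr hDJ, mem_powerset.mpr
        (union_subset hFV (hA.trans sdiff_subset))⟩, hD2, ?_, ?_, ?_⟩
      · simp only; omega
      · simp only
        have : nb (F ∪ A) \ D ⊆ (nb F \ D) ∪ (nb A \ D) := by
          intro b hb
          simp only [nb, mem_sdiff, mem_filter, mem_union] at hb ⊢
          obtain ⟨⟨hbJ, a, ha | ha, hr⟩, hbD⟩ := hb
          · exact Or.inl ⟨⟨hbJ, a, ha, hr⟩, hbD⟩
          · exact Or.inr ⟨⟨hbJ, a, ha, hr⟩, hbD⟩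
        have h3 := (card_le_card this).trans (card_union_le _ _)
        omega
      · simp only
        exact (card_le_card (sdiff_subset_sdiff le_rfl subset_union_left)).trans hDe
    have := hmax _ hmem
    simp only at this
    omega
  have expJ : ∀ B ⊆ J \ D, B.card ≤ f → B.card ≤ (nx B \ F).card := by
    intro B hB hBf
    by_contra! hlt
    have hdisj : Disjoint D B := disjoint_of_subset_right hB disjoint_sdiff
    have hBne : 0 < B.card := by omega
    have hcard := card_union_of_disjoint hdisj
    have hmem : (D ∪ B, F) ∈ (J.powerset ×ˢ V₀.powerset).filter good := by
      refine mem_filter.mpr ⟨mem_product.mpr ⟨mem_powerset.mpr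
        (union_subset hDJ (hB.trans sdiff_subset)), mem_powerset.mpr hFV⟩, ?_, hF2, ?_, ?_⟩
      · simp only; omega
      · simp only
        exact (card_le_card (sdiff_subset_sdiff le_rfl subset_union_left)).trans hFe
      · simp only
        have : nx (D ∪ B) \ F ⊆ (nx D \ F) ∪ (nx B \ F) := by
          intro b hb
          simp only [nx, mem_sdiff, mem_filter, mem_union] at hb ⊢
          obtain ⟨⟨hbJ, a, ha | ha, hr⟩, hbD⟩ := hb
          · exact Or.inl ⟨⟨hbJ, a, ha, hr⟩, hbD⟩
          · exact Or.inr ⟨⟨hbJ, a, ha, hr⟩, hbD⟩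
        have h3 := (card_le_card this).trans (card_union_le _ _)
        omega
    have := hmax _ hmem
    simp only at this
    omega
  refine ⟨D, hDJ, F, hFV, hDf, hFf, fun X hXV' hX₁X hcard => ?_⟩
  refine exists_injOn_of_hall r (J \ D) X fun B hB => ?_
  by_contra! hlt
  by_cases hBf : B.card ≤ f
  · have h1 := expJ B hB hBf
    have h2 : nx B \ F ⊆ X.filter fun a => ∃ b ∈ B, r b a := by
      intro a ha
      obtain ⟨ha1, ha2⟩ := mem_sdiff.mp ha
      obtain ⟨ha3, ha4⟩ := mem_filter.mp ha1
      exact mem_filter.mpr ⟨hX₁X (mem_sdiff.mpr ⟨ha3, ha2⟩), ha4⟩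
    have := card_le_card h2
    omega
  · set A := X.filter fun a => ¬ ∃ b ∈ B, r b a with hAdef
    have hsum := card_filter_add_card_filter_not (s := X) (fun a => ∃ b ∈ B, r b a)
    rw [← hAdef] at hsum
    have hAV : A ⊆ V₀ \ F := (filter_subset _ _).trans hXV'
    have hBmiss : ∀ b ∈ B, ∀ a ∈ A, ¬ r b a := fun b hb a ha hr =>
      (mem_filter.mp ha).2 ⟨b, hb, hr⟩
    have hAf : A.card ≤ f := by
      by_contra! hAf
      have h1 := hL A (hAV.trans sdiff_subset) hAf.le
      have h2 : B ⊆ J.filter fun b => ∀ a ∈ A, ¬ r b a := fun b hb =>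
        mem_filter.mpr ⟨(hB.trans sdiff_subset) hb, hBmiss b hb⟩
      have := card_le_card h2
      omega
    have h1 := expV A hAV hAf
    have h2 : nb A \ D ⊆ (J \ D) \ B := by
      intro b hb
      obtain ⟨hb1, hb2⟩ := mem_sdiff.mp hb
      obtain ⟨hbJ, a, ha, hr⟩ := mem_filter.mp hb1
      exact mem_sdiff.mpr ⟨mem_sdiff.mpr ⟨hbJ, hb2⟩, fun hbB => hBmiss b hbB a ha hr⟩
    have h3 := card_le_card h2
    rw [card_sdiff_of_subset hB] at h3
    have h4 := card_le_card hB
    omega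

end Closure

section Pattern

variable {W : Type} [Fintype W] [DecidableEq W]

/-- Positions `i`, `j` are consecutive on a cycle of length `len`. -/
def CycRel (len i j : ℕ) : Prop :=
  j = i + 1 ∨ i = j + 1 ∨ (i = 0 ∧ j + 1 = len) ∨ (j = 0 ∧ i + 1 = len)

lemma exists_maximal_path (H : SimpleGraph W) (R : Finset W) (hR : R.Nonempty) :
    ∃ P : List W, P.Nodup ∧ P.IsChain H.Adj ∧ (∀ w ∈ P, w ∈ R) ∧ P ≠ [] ∧
      ∀ Q : List W, Q.Nodup → Q.IsChain H.Adj → (∀ w ∈ Q, w ∈ R) → Q.length ≤ P.length := by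
  classical
  let S : ℕ → Prop := fun k => ∃ P : List W, P.Nodup ∧ P.IsChain H.Adj ∧ (∀ w ∈ P, w ∈ R) ∧
    P.length = k
  have hb : ∀ k, S k → k ≤ Fintype.card W := by
    rintro k ⟨P, hP, -, -, rfl⟩
    exact hP.length_le_card
  obtain ⟨w, hw⟩ := hR
  have h1 : S 1 := ⟨[w], by simp, by simp, by simpa using hw, rfl⟩
  obtain ⟨P, hP, hc, hm, hl⟩ := Nat.findGreatest_spec (hb 1 h1) h1
  have hle : ∀ k, S k → k ≤ P.length := fun k hk => by
    rw [hl]; exact Nat.le_findGreatest (hb k hk) hk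
  refine ⟨P, hP, hc, hm, ?_, fun Q h1 h2 h3 => hle _ ⟨Q, h1, h2, h3, rfl⟩⟩
  rintro rfl
  simpa using hle 1 h1

lemma eq_of_adj_three (H : SimpleGraph W) [DecidableRel H.Adj] {v a b c : W}
    (hv : H.degree v ≤ 2) (ha : H.Adj v a) (hb : H.Adj v b) (hc : H.Adj v c) (hab : a ≠ b) :
    c = a ∨ c = b := by
  by_contra! hcon
  have : ({a, b, c} : Finset W) ⊆ H.neighborFinset v := by
    intro x hx
    simp only [mem_insert, mem_singleton] at hx
    rcases hx with rfl | rfl | rfl <;> simpa using by assumption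
  have h1 := card_le_card this
  rw [H.card_neighborFinset_eq_degree, card_eq_three.mpr
    ⟨a, b, c, hab, hcon.1.symm, hcon.2.symm, rfl⟩] at h1
  omega

/-- A graph of maximum degree two is covered by disjoint lists on which every edge is cyclically
consecutive. -/
lemma exists_list_cover (H : SimpleGraph W) [DecidableRel H.Adj] (hdeg : ∀ w, H.degree w ≤ 2)
    (R : Finset W) :
    ∃ LL : List (List W), LL.flatten.Nodup ∧ (∀ w, w ∈ LL.flatten ↔ w ∈ R) ∧
      ∀ u ∈ R, ∀ v ∈ R, H.Adj u v → ∃ L ∈ LL, ∃ i j, L[i]? = some u ∧ L[j]? = some v ∧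
        CycRel L.length i j := by
  induction R using Finset.strongInduction with
  | H R ih =>
  rcases R.eq_empty_or_nonempty with rfl | hR
  · exact ⟨[], by simp, by simp, by simp⟩
  obtain ⟨P, hP, hc, hm, hne, hmax⟩ := exists_maximal_path H R hR
  have hsub : P.toFinset ⊆ R := fun w hw => hm w (List.mem_toFinset.mp hw)
  have hnonempty : P.toFinset.Nonempty := by
    obtain ⟨a, ha⟩ := List.exists_mem_of_ne_nil P hne
    exact ⟨a, List.mem_toFinset.mpr ha⟩
  obtain ⟨LL, hn, hmem, hedge⟩ := ih (R \ P.toFinset) (sdiff_ssubset hsub hnonempty)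
  have hadj : ∀ i (hi : i + 1 < P.length), H.Adj P[i] P[i+1] := fun i hi =>
    List.isChain_iff_getElem.mp hc i hi
  have key : ∀ i (hi : i < P.length) v, v ∈ R → H.Adj P[i] v →
      (0 < i → i + 1 < P.length → P[i-1]? = some v ∨ P[i+1]? = some v) ∧ v ∈ P := by
    intro i hi v hv hiv
    have hinner : 0 < i → i + 1 < P.length → P[i-1]? = some v ∨ P[i+1]? = some v := by
      intro h0 h1
      have e1 := hadj (i - 1) (by omega)
      have e1' : H.Adj P[i] P[i-1] := by
        have : i - 1 + 1 = i := by omega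
        simp only [this] at e1
        exact e1.symm
      have hne' : P[i-1] ≠ P[i+1] := by
        intro h
        have := (hP.getElem_inj_iff).mp h
        omega
      rcases eq_of_adj_three H (hdeg _) e1' (hadj i h1) hiv hne' with rfl | rfl
      · left; simp
      · right; simp
    refine ⟨hinner, ?_⟩
    by_contra hvP
    rcases Nat.eq_zero_or_pos i with rfl | h0
    · have := hmax (v :: P) (List.nodup_cons.mpr ⟨hvP, hP⟩) (by
        rw [List.isChain_cons]
        refine ⟨?_, hc⟩
        intro y hy
        rw [List.head?_eq_getElem?] at hy
        rw [List.getElem?_eq_getElem hi] at hy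
        obtain rfl : P[0] = y := by simpa using hy
        exact hiv.symm) (by
        intro w hw
        rcases List.mem_cons.mp hw with rfl | hw
        · exact hv
        · exact hm w hw)
      simp at this
    · by_cases h1 : i + 1 < P.length
      · rcases hinner h0 h1 with h | h <;> exact hvP (List.mem_of_getElem? h)
      · have := hmax (P ++ [v]) (by
          rw [List.nodup_append]
          refine ⟨hP, by simp, ?_⟩
          rintro a ha b hb rfl
          rw [List.mem_singleton] at hb
          exact hvP (hb ▸ ha)) (by
          rw [List.isChain_append]
          refine ⟨hc, by simp, ?_⟩
          intro x hx y hy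
          rw [List.getLast?_eq_getElem?] at hx
          obtain rfl : v = y := by simpa using hy
          have : P.length - 1 = i := by omega
          rw [this, List.getElem?_eq_getElem hi] at hx
          obtain rfl : P[i] = x := by simpa using hx
          exact hiv) (by
          intro w hw
          rcases List.mem_append.mp hw with hw | hw
          · exact hm w hw
          · rw [List.mem_singleton] at hw; exact hw ▸ hv)
        simp at this
  refine ⟨P :: LL, ?_, ?_, ?_⟩
  · rw [List.flatten_cons, List.nodup_append]
    refine ⟨hP, hn, ?_⟩
    rintro a ha b hb rfl
    have := (hmem a).mp hb
    simp [ha] at this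
  · intro w
    rw [List.flatten_cons, List.mem_append, hmem, mem_sdiff, List.mem_toFinset]
    constructor
    · rintro (h | h)
      · exact hm w h
      · exact h.1
    · intro h
      by_cases hw : w ∈ P
      · exact Or.inl hw
      · exact Or.inr ⟨h, hw⟩
  · intro u hu v hv huv
    by_cases huP : u ∈ P
    · obtain ⟨i, hi, rfl⟩ := List.mem_iff_getElem.mp huP
      obtain ⟨hinner, hvP⟩ := key i hi v hv huv
      obtain ⟨j, hj, rfl⟩ := List.mem_iff_getElem.mp hvP
      obtain ⟨hinner', -⟩ := key j hj _ hu huv.symm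
      refine ⟨P, by simp, i, j, by simp, by simp, ?_⟩
      have hij : i ≠ j := by rintro rfl; exact H.irrefl huv
      have inj : ∀ a, P[a]? = some P[j] → a = j := by
        intro a ha
        obtain ⟨ha1, ha2⟩ := List.getElem?_eq_some_iff.mp ha
        exact (hP.getElem_inj_iff).mp ha2
      have inj' : ∀ a, P[a]? = some P[i] → a = i := by
        intro a ha
        obtain ⟨ha1, ha2⟩ := List.getElem?_eq_some_iff.mp ha
        exact (hP.getElem_inj_iff).mp ha2
      unfold CycRel
      by_cases hi' : 0 < i ∧ i + 1 < P.length
      · rcases hinner hi'.1 hi'.2 with h | h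
        · have := inj _ h; omega
        · have := inj _ h; omega
      · by_cases hj' : 0 < j ∧ j + 1 < P.length
        · rcases hinner' hj'.1 hj'.2 with h | h
          · have := inj' _ h; omega
          · have := inj' _ h; omega
        · omega
    · have hvP : v ∉ P := by
        intro hvP
        obtain ⟨j, hj, rfl⟩ := List.mem_iff_getElem.mp hvP
        exact huP (key j hj u hu huv.symm).2
      obtain ⟨L, hL, h⟩ := hedge u (by simp [hu, huP]) v (by simp [hv, hvP]) huv
      exact ⟨L, List.mem_cons_of_mem _ hL, h⟩

/-- Disjoint cycles of lengths `ℓ i`, avoiding `E₀`, given by their vertices in cyclic order. -/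
def IsCycleFamily {V ι : Type} (G : SimpleGraph V) (ℓ : ι → ℕ) (E₀ : Finset V)
    (C : ι → ℕ → V) : Prop :=
  (∀ i j i' j', j < ℓ i → j' < ℓ i' → C i j = C i' j' → i = i' ∧ j = j') ∧
  (∀ i j, j < ℓ i → C i j ∉ E₀) ∧
  (∀ i j, j + 1 < ℓ i → G.Adj (C i j) (C i (j + 1))) ∧
  ∀ i, G.Adj (C i (ℓ i - 1)) (C i 0)

lemma IsCycleFamily.adj_of_cycRel {V ι : Type} {G : SimpleGraph V} {ℓ : ι → ℕ} {E₀ : Finset V}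
    {C : ι → ℕ → V} (h : IsCycleFamily G ℓ E₀ C) {i : ι} {a b : ℕ} (ha : a < ℓ i) (hb : b < ℓ i)
    (hab : CycRel (ℓ i) a b) : G.Adj (C i a) (C i b) := by
  obtain ⟨-, -, h1, h2⟩ := h
  rcases hab with rfl | rfl | ⟨rfl, h⟩ | ⟨rfl, h⟩
  · exact h1 i a hb
  · exact (h1 i b ha).symm
  · have := h2 i
    rw [show ℓ i - 1 = b by omega] at this
    exact this.symm
  · have := h2 i
    rwa [show ℓ i - 1 = a by omega] at this

/-- A graph of maximum degree at most two embeds as soon as all families of disjoint cycles that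
span all but at most two prescribed vertices exist. -/
theorem exists_copy_of_cycles {V : Type} [Fintype V] [DecidableEq V] (G : SimpleGraph V)
    (hG : ∃ a b, G.Adj a b)
    (hcore : ∀ (ι : Type) [Fintype ι] [DecidableEq ι] (ℓ : ι → ℕ) (E₀ : Finset V), E₀.card ≤ 2 →
      (∀ i, 3 ≤ ℓ i) → ∑ i, ℓ i + E₀.card = Fintype.card V → ∃ C, IsCycleFamily G ℓ E₀ C)
    (H : SimpleGraph W) [DecidableRel H.Adj] (hW : Fintype.card W ≤ Fintype.card V)
    (hdeg : ∀ w, H.degree w ≤ 2) :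
    ∃ φ : W → V, Function.Injective φ ∧ ∀ u v : W, H.Adj u v → G.Adj (φ u) (φ v) := by
  obtain ⟨LL, hn, hmem, hedge⟩ := exists_list_cover H hdeg univ
  simp only [mem_univ, iff_true, true_implies] at hmem hedge
  set long := LL.filter fun L => 3 ≤ L.length with hlong
  set short := LL.filter fun L => ¬ 3 ≤ L.length with hshort
  have hperm : (short ++ long).Perm LL := by
    have h1 := List.filter_append_perm (fun L : List W => decide (¬ 3 ≤ L.length)) LL
    have h2 : LL.filter (fun L => !decide (¬ 3 ≤ L.length)) = long := by
      rw [hlong]; refine List.filter_congr fun L _ => ?_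
      by_cases h : 3 ≤ L.length <;> simp [h]
    rw [h2] at h1
    exact h1
  set M := short.flatten with hM
  have hpf : (M ++ long.flatten).Perm LL.flatten := by
    rw [hM, ← List.flatten_append]; exact hperm.flatten
  have hnd : (M ++ long.flatten).Nodup := hpf.nodup_iff.mpr hn
  obtain ⟨hMn, hln, hMl⟩ := List.nodup_append.mp hnd
  obtain ⟨hlnd, hlpw⟩ := List.nodup_flatten.mp hln
  have hlen : M.length + ∑ i : Fin long.length, long[i].length = Fintype.card W := by
    have h1 : (M ++ long.flatten).length = Fintype.card W := by
      rw [← List.toFinset_card_of_nodup hnd, ← card_univ]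
      congr 1
      ext w
      simp only [List.mem_toFinset, mem_univ, iff_true]
      exact hpf.mem_iff.mpr (hmem w)
    rw [List.length_append] at h1
    have h2 : long.flatten.length = ∑ i : Fin long.length, long[i].length := by
      rw [List.length_flatten, ← Fin.sum_univ_fun_getElem]
      rfl
    rw [← h1, h2]
  set L' : Option (Fin long.length) → List W := fun o => o.elim M fun i => long[i] with hL'
  have huniq : ∀ o (a : ℕ) o' (a' : ℕ) w, (L' o)[a]? = some w → (L' o')[a']? = some w →
      o = o' ∧ a = a' := by
    intro o a o' a' w h1 h2
    have hsame : ∀ o, (L' o).Nodup := by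
      rintro (_ | i)
      · exact hMn
      · exact hlnd _ (List.getElem_mem _)
    have ho : o = o' := by
      have m1 := List.mem_of_getElem? h1
      have m2 := List.mem_of_getElem? h2
      rcases o with _ | i <;> rcases o' with _ | i'
      · rfl
      · exact absurd rfl (hMl w m1 w (List.mem_flatten.mpr ⟨_, List.getElem_mem _, m2⟩))
      · exact absurd rfl (hMl w m2 w (List.mem_flatten.mpr ⟨_, List.getElem_mem _, m1⟩))
      · by_contra hne
        have hne' : (i : ℕ) ≠ i' := fun h => hne (by rw [Fin.ext h])
        rcases Nat.lt_or_gt_of_ne hne' with h | h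
        · exact (List.pairwise_iff_getElem.mp hlpw _ _ i.2 i'.2 h) m1 m2
        · exact (List.pairwise_iff_getElem.mp hlpw _ _ i'.2 i.2 h) m2 m1
    subst ho
    refine ⟨rfl, ?_⟩
    obtain ⟨p1, q1⟩ := List.getElem?_eq_some_iff.mp h1
    obtain ⟨p2, q2⟩ := List.getElem?_eq_some_iff.mp h2
    exact ((hsame o).getElem_inj_iff).mp (q1.trans q2.symm)
  have hpos : ∀ w, ∃ o, ∃ a : ℕ, (L' o)[a]? = some w := by
    intro w
    rcases List.mem_append.mp (hpf.mem_iff.mpr (hmem w)) with h | h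
    · obtain ⟨a, ha⟩ := List.mem_iff_getElem?.mp h
      exact ⟨none, a, ha⟩
    · obtain ⟨L, hL, hw⟩ := List.mem_flatten.mp h
      obtain ⟨i, hi, rfl⟩ := List.mem_iff_getElem.mp hL
      obtain ⟨a, ha⟩ := List.mem_iff_getElem?.mp hw
      exact ⟨some ⟨i, hi⟩, a, ha⟩
  have hedge' : ∀ u v, H.Adj u v → ∃ o, ∃ a b : ℕ, (L' o)[a]? = some u ∧ (L' o)[b]? = some v ∧
      (if o = none then b = a + 1 ∨ a = b + 1 else CycRel (L' o).length a b) := by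
    intro u v huv
    obtain ⟨L, hL, a, b, ha, hb, hr⟩ := hedge u v huv
    by_cases h3 : 3 ≤ L.length
    · have : L ∈ long := List.mem_filter.mpr ⟨hL, by simpa using h3⟩
      obtain ⟨i, hi, rfl⟩ := List.mem_iff_getElem.mp this
      exact ⟨some ⟨i, hi⟩, a, b, ha, hb, by
        rw [if_neg (Option.some_ne_none _)]; exact hr⟩
    · have : L ∈ short := List.mem_filter.mpr ⟨hL, by simpa using h3⟩
      obtain ⟨s, t, hst⟩ := List.append_of_mem this
      have hMeq : M = s.flatten ++ (L ++ t.flatten) := by rw [hM, hst]; simp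
      have ha' := (List.getElem?_eq_some_iff.mp ha).1
      have hb' := (List.getElem?_eq_some_iff.mp hb).1
      have hab : a ≠ b := by
        rintro rfl
        rw [ha] at hb
        exact H.irrefl (Option.some.inj hb ▸ huv)
      refine ⟨none, s.flatten.length + a, s.flatten.length + b, ?_, ?_, ?_⟩
      · show M[_]? = _
        rw [hMeq, List.getElem?_append_right (by omega), List.getElem?_append_left (by omega)]
        simpa using ha
      · show M[_]? = _
        rw [hMeq, List.getElem?_append_right (by omega), List.getElem?_append_left (by omega)]
        simpa using hb
      · simp only [if_true]
        unfold CycRel at hr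
        omega
  obtain ⟨C, hCinj, hCadj⟩ : ∃ C : Option (Fin long.length) → ℕ → V,
      (∀ o a o' a', a < (L' o).length → a' < (L' o').length → C o a = C o' a' →
        o = o' ∧ a = a') ∧
      ∀ o a b, a < (L' o).length → b < (L' o).length →
        (if o = none then b = a + 1 ∨ a = b + 1 else CycRel (L' o).length a b) →
        G.Adj (C o a) (C o b) := by
    have h3 : ∀ i : Fin long.length, 3 ≤ long[i].length := by
      intro i
      have := (List.mem_filter.mp (List.getElem_mem i.2)).2
      simpa using this
    obtain ⟨m, hm⟩ := Nat.exists_eq_add_of_le (show ∑ i : Fin long.length, long[i].length ≤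
      Fintype.card V by omega)
    by_cases hm3 : 3 ≤ m
    · let ℓ : Option (Fin long.length) → ℕ := fun o => o.elim m fun i => long[i].length
      obtain ⟨C, hC⟩ := hcore (Option (Fin long.length)) ℓ ∅ (by simp)
        (by rintro (_ | i); exacts [hm3, h3 i]) (by
          rw [Fintype.sum_option, card_empty]
          show m + ∑ i : Fin long.length, long[i].length + 0 = _
          omega)
      have hle : ∀ o, (L' o).length ≤ ℓ o := by
        rintro (_ | i)
        · show M.length ≤ m
          omega
        · exact le_rfl
      refine ⟨C, fun o a o' a' h1 h2 => hC.1 o a o' a' (h1.trans_le (hle _)) (h2.trans_le (hle _)),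
        ?_⟩
      intro o a b ha hb hab
      refine hC.adj_of_cycRel (ha.trans_le (hle _)) (hb.trans_le (hle _)) ?_
      rcases o with _ | i
      · simp only [if_true] at hab
        unfold CycRel; omega
      · rw [if_neg (Option.some_ne_none _)] at hab; exact hab
    · obtain ⟨x, y, hxy⟩ := hG
      have hM2 : M.length ≤ m := by omega
      let E₀ : Finset V := if m = 0 then ∅ else if m = 1 then {x} else {x, y}
      have hE : E₀.card = m := by
        have hc : m = 0 ∨ m = 1 ∨ m = 2 := by omega
        rcases hc with h | h | h <;> simp [E₀, h, hxy.ne]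
      have hxE : 0 < m → x ∈ E₀ := by
        intro h
        have hc : m = 1 ∨ m = 2 := by omega
        rcases hc with h | h <;> simp [E₀, h]
      have hyE : 1 < m → y ∈ E₀ := by
        intro h
        have hc : m = 2 := by omega
        simp [E₀, hc]
      obtain ⟨C, hC⟩ := hcore (Fin long.length) (fun i => long[i].length) E₀ (by omega) h3
        (by omega)
      have hnone : ∀ a, a < M.length → (if a = 0 then x else y) ∈ E₀ := by
        intro a ha
        split_ifs with h
        · exact hxE (by omega)
        · exact hyE (by omega)
      refine ⟨fun o a => o.elim (if a = 0 then x else y) fun i => C i a, ?_, ?_⟩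
      · intro o a o' a' h1 h2 h
        rcases o with _ | i <;> rcases o' with _ | i'
        · refine ⟨rfl, ?_⟩
          replace h1 : a < M.length := h1
          replace h2 : a' < M.length := h2
          simp only [Option.elim] at h
          split_ifs at h with h3 h4 h4
          · omega
          · exact absurd h hxy.ne
          · exact absurd h.symm hxy.ne
          · omega
        · simp only [Option.elim] at h
          exact absurd (h ▸ hnone a h1) (hC.2.1 i' a' h2)
        · simp only [Option.elim] at h
          exact absurd (h ▸ hnone a' h2) (hC.2.1 i a h1)
        · have := hC.1 i a i' a' h1 h2 h
          exact ⟨by rw [this.1], this.2⟩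
      · intro o a b ha hb hab
        rcases o with _ | i
        · replace ha : a < M.length := ha
          replace hb : b < M.length := hb
          simp only [if_true] at hab
          simp only [Option.elim]
          rcases hab with rfl | rfl
          · rw [if_pos (by omega), if_neg (by omega)]; exact hxy
          · rw [if_neg (by omega), if_pos (by omega)]; exact hxy.symm
        · rw [if_neg (Option.some_ne_none _)] at hab
          exact hC.adj_of_cycRel ha hb hab
  choose o a hoa using hpos
  have hlt : ∀ w, a w < (L' (o w)).length := fun w => (List.getElem?_eq_some_iff.mp (hoa w)).1
  refine ⟨fun w => C (o w) (a w), ?_, ?_⟩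
  · intro u v huv
    obtain ⟨h1, h2⟩ := hCinj _ _ _ _ (hlt u) (hlt v) huv
    have hu := hoa u
    rw [h1, h2, hoa v] at hu
    exact (Option.some.inj hu).symm
  · intro u v huv
    obtain ⟨q, i, j, hi, hj, hr⟩ := hedge' u v huv
    obtain ⟨rfl, rfl⟩ := huniq _ _ _ _ _ (hoa u) hi
    obtain ⟨h1, rfl⟩ := huniq _ _ _ _ _ (hoa v) hj
    have := hCadj (o u) (a u) (a v) (hlt u) (h1 ▸ hlt v) hr
    show G.Adj (C (o u) (a u)) (C (o v) (a v))
    rwa [h1]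

end Pattern

section Blocks

/-- Disjoint paths `P b` on `s b` vertices avoiding `E₀`, the last vertex of each being adjacent to
the first vertex of the next. -/
def IsBlockFamily {V β : Type} (G : SimpleGraph V) (s : β → ℕ) (next : β → β) (E₀ : Finset V)
    (P : β → List V) : Prop :=
  (∀ b, (P b).length = s b) ∧ (∀ b, (P b).Nodup) ∧ (∀ b, (P b).IsChain G.Adj) ∧
  (∀ b, ∀ x ∈ (P b).getLast?, ∀ y ∈ (P (next b)).head?, G.Adj x y) ∧
  (∀ b c, b ≠ c → ∀ x ∈ P b, x ∉ P c) ∧ ∀ b, ∀ x ∈ P b, x ∉ E₀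

lemma sum_ite_last (a m : ℕ) (hm : 1 ≤ m) :
    ∑ t : Fin m, (if (t : ℕ) + 1 = m then a else 5) = 5 * (m - 1) + a := by
  obtain ⟨k, rfl⟩ : ∃ k, m = k + 1 := ⟨m - 1, by omega⟩
  rw [Fin.sum_univ_castSucc]
  simp only [Fin.val_castSucc, Fin.val_last, if_true]
  rw [sum_congr rfl (g := fun _ => 5) fun t _ => if_neg (by have := t.2; omega)]
  simp
  omega

/-- Cycles can be cut into blocks of between three and nine vertices. -/
theorem exists_cycleFamily_of_blocks {V : Type} [Fintype V] [DecidableEq V] [Nonempty V]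
    (G : SimpleGraph V) (E₀ : Finset V)
    (hcore : ∀ (β : Type) [Fintype β] [DecidableEq β] (s : β → ℕ) (next : β → β),
      Function.Injective next → (∀ b, 3 ≤ s b) → (∀ b, s b ≤ 9) → (∀ b, s b < 5 → next b = b) →
      ∑ b, s b + E₀.card = Fintype.card V → ∃ P, IsBlockFamily G s next E₀ P)
    (ι : Type) [Fintype ι] [DecidableEq ι] (ℓ : ι → ℕ) (hℓ : ∀ i, 3 ≤ ℓ i)
    (hsum : ∑ i, ℓ i + E₀.card = Fintype.card V) : ∃ C, IsCycleFamily G ℓ E₀ C := by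
  obtain ⟨m, hm⟩ : ∃ m : ι → ℕ, ∀ i, m i = max 1 (ℓ i / 5) := ⟨_, fun _ => rfl⟩
  have hm1 : ∀ i, 1 ≤ m i := fun i => by rw [hm]; exact le_max_left _ _
  have hml : ∀ i, 5 * (m i - 1) + 3 ≤ ℓ i ∧ ℓ i ≤ 5 * (m i - 1) + 9 ∧
      (ℓ i < 5 * (m i - 1) + 5 → m i = 1) := by
    intro i
    have h1 := hm i
    have h2 := hℓ i
    rcases Nat.lt_or_ge (ℓ i) 5 with h | h
    · have : ℓ i / 5 = 0 := by omega
      rw [this] at h1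
      simp at h1
      omega
    · have : max 1 (ℓ i / 5) = ℓ i / 5 := max_eq_right (by omega)
      omega
  let s : (Σ i, Fin (m i)) → ℕ := fun b =>
    if (b.2 : ℕ) + 1 = m b.1 then ℓ b.1 - 5 * (m b.1 - 1) else 5
  let next : (Σ i, Fin (m i)) → Σ i, Fin (m i) := fun b =>
    ⟨b.1, ⟨(b.2 + 1) % m b.1, Nat.mod_lt _ (hm1 b.1)⟩⟩
  have hnext : ∀ i (t : ℕ) (ht : t < m i), next ⟨i, ⟨t, ht⟩⟩ =
      ⟨i, ⟨(t + 1) % m i, Nat.mod_lt _ (hm1 i)⟩⟩ := fun _ _ _ => rfl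
  obtain ⟨P, hlen, hnd, hch, hlink, hdis, hav⟩ := hcore (Σ i, Fin (m i)) s next (by
      rintro ⟨i, t, ht⟩ ⟨i', t', ht'⟩ h
      rw [hnext, hnext] at h
      obtain rfl : i = i' := congrArg Sigma.fst h
      have h2 : (t + 1) % m i = (t' + 1) % m i := by
        have := eq_of_heq (Sigma.mk.inj h).2
        exact congrArg Fin.val this
      have : t = t' := by
        rcases Nat.lt_or_ge (t + 1) (m i) with h3 | h3 <;>
        rcases Nat.lt_or_ge (t' + 1) (m i) with h4 | h4
        · rw [Nat.mod_eq_of_lt h3, Nat.mod_eq_of_lt h4] at h2; omega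
        · rw [Nat.mod_eq_of_lt h3, show t' + 1 = m i by omega, Nat.mod_self] at h2; omega
        · rw [Nat.mod_eq_of_lt h4, show t + 1 = m i by omega, Nat.mod_self] at h2; omega
        · omega
      subst this
      rfl)
    (by
      rintro ⟨i, t, ht⟩
      have := hml i
      simp only [s]
      split_ifs <;> omega)
    (by
      rintro ⟨i, t, ht⟩
      have := hml i
      simp only [s]
      split_ifs <;> omega)
    (by
      rintro ⟨i, t, ht⟩ h
      have h1 := hml i
      simp only [s] at h
      split_ifs at h with h2
      · have h3 : m i = 1 := h1.2.2 (by omega)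
        rw [hnext]
        congr 2
        rw [h3, Nat.mod_one]; omega
      · omega)
    (by
      rw [← hsum, Fintype.sum_sigma]
      congr 1
      refine sum_congr rfl fun i _ => ?_
      simp only [s]
      rw [sum_ite_last _ _ (hm1 i)]
      have := hml i
      omega)
  obtain ⟨q, hq⟩ : ∃ q : ι → ℕ → ℕ, ∀ i j, q i j = min (j / 5) (m i - 1) := ⟨_, fun _ _ => rfl⟩
  have hqm : ∀ i j, q i j < m i := fun i j => by have := hq i j; have := hm1 i; omega
  have hqs : ∀ i j, j < ℓ i → j - 5 * q i j < s ⟨i, ⟨q i j, hqm i j⟩⟩ ∧ 5 * q i j ≤ j := by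
    intro i j hj
    have h1 := hq i j
    have h2 := hml i
    have h3 := hm1 i
    simp only [s]
    split_ifs <;> omega
  let C : ι → ℕ → V := fun i j =>
    (P ⟨i, ⟨q i j, hqm i j⟩⟩).getD (j - 5 * q i j) (Classical.arbitrary V)
  have hC : ∀ i j, j < ℓ i → (P ⟨i, ⟨q i j, hqm i j⟩⟩)[j - 5 * q i j]? = some (C i j) := by
    intro i j hj
    have h : j - 5 * q i j < (P ⟨i, ⟨q i j, hqm i j⟩⟩).length := by
      rw [hlen]; exact (hqs i j hj).1
    simp only [C]
    rw [List.getD_eq_getElem _ _ h, List.getElem?_eq_getElem h]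
  have hmem : ∀ i j, j < ℓ i → C i j ∈ P ⟨i, ⟨q i j, hqm i j⟩⟩ := fun i j hj =>
    List.mem_of_getElem? (hC i j hj)
  refine ⟨C, ?_, fun i j hj => hav _ _ (hmem i j hj), ?_, ?_⟩
  · intro i j i' j' hj hj' h
    have hb : (⟨i, ⟨q i j, hqm i j⟩⟩ : Σ i, Fin (m i)) = ⟨i', ⟨q i' j', hqm i' j'⟩⟩ := by
      by_contra hne
      exact hdis _ _ hne _ (hmem i j hj) (h ▸ hmem i' j' hj')
    have e1 := hC i j hj
    have e2 := hC i' j' hj'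
    rw [← hb, ← h] at e2
    obtain rfl : i = i' := congrArg Sigma.fst hb
    have h2 : q i j = q i j' := by
      have := eq_of_heq (Sigma.mk.inj hb).2
      exact congrArg Fin.val this
    obtain ⟨p1, q1⟩ := List.getElem?_eq_some_iff.mp e1
    obtain ⟨p2, q2⟩ := List.getElem?_eq_some_iff.mp e2
    have := ((hnd _).getElem_inj_iff).mp (q1.trans q2.symm)
    have h3 := (hqs i j hj).2
    have h4 := (hqs i j' hj').2
    exact ⟨rfl, by omega⟩
  · intro i j hj
    have e1 := hC i j (by omega)
    have e2 := hC i (j + 1) hj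
    have h1 := hqs i j (by omega)
    have h2 := hqs i (j + 1) hj
    by_cases hqq : q i (j + 1) = q i j
    · have hb : (⟨i, ⟨q i (j + 1), hqm i (j + 1)⟩⟩ : Σ i, Fin (m i)) = ⟨i, ⟨q i j, hqm i j⟩⟩ := by
        congr 2
      rw [hb, hqq, show j + 1 - 5 * q i j = (j - 5 * q i j) + 1 by omega] at e2
      obtain ⟨p1, q1⟩ := List.getElem?_eq_some_iff.mp e1
      obtain ⟨p2, q2⟩ := List.getElem?_eq_some_iff.mp e2
      rw [← q1, ← q2]
      exact List.isChain_iff_getElem.mp (hch _) _ p2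
    · have h3 := hq i j
      have h4 := hq i (j + 1)
      have h5 : q i (j + 1) = q i j + 1 := by omega
      have h6 := hqm i (j + 1)
      have hs : s ⟨i, ⟨q i j, hqm i j⟩⟩ = 5 := by
        simp only [s]
        rw [if_neg (by omega)]
      have hj5 : j - 5 * q i j = 4 := by omega
      have hj0 : j + 1 - 5 * q i (j + 1) = 0 := by omega
      refine hlink ⟨i, ⟨q i j, hqm i j⟩⟩ _ ?_ _ ?_
      · rw [List.getLast?_eq_getElem?, hlen, hs]
        rw [hj5] at e1
        exact e1
      · have hb : next ⟨i, ⟨q i j, hqm i j⟩⟩ = ⟨i, ⟨q i (j + 1), hqm i (j + 1)⟩⟩ := by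
          rw [hnext]
          congr 2
          rw [h5, Nat.mod_eq_of_lt (by omega)]
        rw [hb, List.head?_eq_getElem?]
        rw [hj0] at e2
        exact e2
  · intro i
    have h0 := hml i
    have e1 := hC i (ℓ i - 1) (by omega)
    have e2 := hC i 0 (by omega)
    have h3 := hq i (ℓ i - 1)
    have h4 := hq i 0
    have hm1' := hm1 i
    have h5 : q i (ℓ i - 1) = m i - 1 := by
      by_cases m i = 1
      · omega
      · omega
    refine hlink ⟨i, ⟨q i (ℓ i - 1), hqm i (ℓ i - 1)⟩⟩ _ ?_ _ ?_
    · have hs : s ⟨i, ⟨q i (ℓ i - 1), hqm i (ℓ i - 1)⟩⟩ = ℓ i - 5 * (m i - 1) := by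
        simp only [s]
        rw [if_pos (by omega)]
      rw [List.getLast?_eq_getElem?, hlen, hs]
      rw [show ℓ i - 5 * (m i - 1) - 1 = ℓ i - 1 - 5 * q i (ℓ i - 1) by omega]
      exact e1
    · have hb : next ⟨i, ⟨q i (ℓ i - 1), hqm i (ℓ i - 1)⟩⟩ = ⟨i, ⟨q i 0, hqm i 0⟩⟩ := by
        rw [hnext]
        congr 2
        rw [h5, Nat.sub_add_cancel hm1', Nat.mod_self]
        omega
      rw [hb, List.head?_eq_getElem?]
      rw [show 0 - 5 * q i 0 = 0 by omega] at e2
      exact e2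

end Blocks

section Reserve

variable {V : Type} [Fintype V] [DecidableEq V]

/-- Chernoff-type count: few colourings give a fixed set few vertices of a fixed colour. -/
lemma card_sparse_colorings_le (q : ℕ) (N : Finset V) (i : Fin q) :
    ((univ.filter fun f : V → Fin q =>
      ((N.filter fun u => f u = i).card : ℝ) ≤ N.card / (4 * q)).card : ℝ) ≤
      (q : ℝ) ^ Fintype.card V * Real.exp (-(N.card / (4 * q))) := by
  have hq : (0 : ℝ) < q := by exact_mod_cast i.pos
  set a : ℝ := Real.exp (-1) with ha
  have ha0 : 0 < a := Real.exp_pos _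
  have ha2 : a ≤ 1 / 2 := by
    rw [ha, Real.exp_neg, inv_eq_one_div]
    apply one_div_le_one_div_of_le (by norm_num)
    have := Real.exp_one_gt_d9
    linarith
  set w : V → Fin q → ℝ := fun u c => if u ∈ N ∧ c = i then a else 1 with hw
  have hw0 : ∀ u c, 0 ≤ w u c := fun u c => by
    simp only [hw]; split_ifs <;> linarith
  have hprod : ∀ f : V → Fin q,
      ∏ u, w u (f u) = Real.exp (-((N.filter fun u => f u = i).card : ℝ)) := by
    intro f
    simp only [hw]
    rw [prod_ite, prod_const, prod_const_one, mul_one, ha, ← Real.exp_nat_mul]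
    congr 1
    have : (univ.filter fun u => u ∈ N ∧ f u = i) = N.filter fun u => f u = i := by
      ext u; simp
    rw [this]; ring
  have hsum : ∑ f : V → Fin q, ∏ u, w u (f u) ≤
      (q : ℝ) ^ Fintype.card V * Real.exp (-(N.card / (2 * q))) := by
    rw [← Fintype.piFinset_univ, ← prod_univ_sum]
    have h1 : ∀ u ∈ (univ : Finset V), ∑ c, w u c ≤
        q * (if u ∈ N then Real.exp (-(1 / (2 * q))) else 1) := by
      intro u _
      split_ifs with hu
      · have : ∑ c, w u c = q - 1 + a := by
          rw [← add_sum_erase _ _ (mem_univ i)]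
          rw [sum_congr rfl (g := fun _ => (1 : ℝ)) fun c hc => by
            simp only [hw]
            rw [if_neg fun h => (mem_erase.mp hc).1 h.2]]
          simp only [hw, hu, sum_const, card_erase_of_mem (mem_univ i), card_univ, Fintype.card_fin]
          simp only [and_self, if_true, nsmul_eq_mul, mul_one]
          rw [Nat.cast_sub i.pos]
          push_cast; ring
        rw [this]
        have h2 := Real.add_one_le_exp (-(1 / (2 * (q : ℝ))))
        have h3 : (q : ℝ) * (-(1 / (2 * q)) + 1) = q - 1 / 2 := by field_simp; ring
        have h4 := mul_le_mul_of_nonneg_left h2 hq.le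
        linarith
      · simp [hw, hu]
    refine (prod_le_prod (fun u _ => sum_nonneg fun c _ => hw0 u c) h1).trans ?_
    rw [prod_mul_distrib, prod_const, card_univ, prod_ite, prod_const, prod_const_one, mul_one,
      ← Real.exp_nat_mul]
    have : (univ.filter fun u => u ∈ N) = N := by ext; simp
    rw [this]
    apply le_of_eq
    congr 2
    ring
  set T := univ.filter fun f : V → Fin q =>
    ((N.filter fun u => f u = i).card : ℝ) ≤ N.card / (4 * q) with hT
  have hbad : (T.card : ℝ) * Real.exp (-(N.card / (4 * q))) ≤ ∑ f : V → Fin q, ∏ u, w u (f u) := by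
    have h1 : ∀ f ∈ T, Real.exp (-((N.card : ℝ) / (4 * q))) ≤ ∏ u, w u (f u) := by
      intro f hf
      rw [hprod]
      rw [hT, mem_filter] at hf
      exact Real.exp_le_exp.mpr (neg_le_neg hf.2)
    have h2 := card_nsmul_le_sum T _ _ h1
    rw [nsmul_eq_mul] at h2
    exact h2.trans (sum_le_sum_of_subset_of_nonneg (subset_univ T)
      fun f _ _ => prod_nonneg fun u _ => hw0 u _)
  have h := hbad.trans hsum
  have he : Real.exp (-(N.card / (2 * (q : ℝ)))) =
      Real.exp (-(N.card / (4 * q))) * Real.exp (-(N.card / (4 * q))) := by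
    rw [← Real.exp_add]; congr 1; field_simp; ring
  rw [he, ← mul_assoc] at h
  exact le_of_mul_le_mul_right h (Real.exp_pos _)

/-- There is a small set meeting every neighbourhood in a constant proportion. -/
lemma exists_reserve (G : SimpleGraph V) [DecidableRel G.Adj] (q : ℕ) (hq : 0 < q) (d : ℝ)
    (hd : ∀ v, d ≤ G.degree v)
    (hexp : (Fintype.card V : ℝ) * q * Real.exp (-(d / (4 * q))) < 1) :
    ∃ C : Finset V, C.card * q ≤ Fintype.card V ∧
      ∀ v, d / (4 * q) ≤ (nbrIn G v C).card := by
  have hq' : (0 : ℝ) < q := by exact_mod_cast hq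
  have : Nonempty (Fin q) := ⟨⟨0, hq⟩⟩
  let bad : V × Fin q → Finset (V → Fin q) := fun x => univ.filter fun f =>
    (((G.neighborFinset x.1).filter fun u => f u = x.2).card : ℝ) ≤
      (G.neighborFinset x.1).card / (4 * q)
  have hcard : ((univ.biUnion bad).card : ℝ) < Fintype.card (V → Fin q) := by
    have h1 : ((univ.biUnion bad).card : ℝ) ≤ ∑ x, ((bad x).card : ℝ) := by
      exact_mod_cast card_biUnion_le
    have h2 : ∑ x, ((bad x).card : ℝ) ≤ ∑ x : V × Fin q,
        (q : ℝ) ^ Fintype.card V * Real.exp (-(d / (4 * q))) := by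
      refine sum_le_sum fun x _ => (card_sparse_colorings_le q _ x.2).trans ?_
      gcongr
      rw [G.card_neighborFinset_eq_degree]
      exact hd x.1
    rw [sum_const, card_univ, Fintype.card_prod, Fintype.card_fin, nsmul_eq_mul] at h2
    have h3 : (Fintype.card (V → Fin q) : ℝ) = (q : ℝ) ^ Fintype.card V := by
      rw [Fintype.card_fun, Fintype.card_fin]; push_cast; rfl
    rw [h3]
    have h4 : (0 : ℝ) < (q : ℝ) ^ Fintype.card V := by positivity
    push_cast at h2
    nlinarith
  obtain ⟨f, hf⟩ : ∃ f, f ∉ univ.biUnion bad := by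
    by_contra! hall
    have : univ.biUnion bad = univ := eq_univ_iff_forall.mpr hall
    rw [this, card_univ] at hcard
    exact lt_irrefl _ hcard
  obtain ⟨i, hi⟩ := Fintype.exists_card_fiber_le_of_card_le_nsmul (f := f)
    (b := (Fintype.card V : ℝ) / q) (by
      rw [Fintype.card_fin, nsmul_eq_mul]
      exact le_of_eq (by field_simp))
  refine ⟨univ.filter fun u => f u = i, ?_, fun v => ?_⟩
  · rw [le_div_iff₀ hq'] at hi
    exact_mod_cast hi
  · have h1 : f ∉ bad (v, i) := fun h => hf (mem_biUnion.mpr ⟨_, mem_univ _, h⟩)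
    simp only [bad, mem_filter, mem_univ, true_and, not_le] at h1
    have h2 : (G.neighborFinset v).filter (fun u => f u = i) =
        nbrIn G v (univ.filter fun u => f u = i) := by
      ext u; simp [nbrIn, and_comm]
    rw [h2, G.card_neighborFinset_eq_degree] at h1
    refine le_trans ?_ h1.le
    gcongr
    exact hd v

end Reserve

section Connecting

variable {V β : Type} [Fintype V] [DecidableEq V] [DecidableEq β] {G : SimpleGraph V}
  [DecidableRel G.Adj]

/-- Any two sets of at least `m` vertices are joined by an edge. -/
def JoinsLarge (G : SimpleGraph V) (m : ℕ) : Prop :=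
  ∀ A B : Finset V, m ≤ A.card → m ≤ B.card → ∃ a ∈ A, ∃ b ∈ B, G.Adj a b

/-- Few vertices have fewer than `4 * m` neighbours in a set of size at least `u₀`. -/
def ReachesLarge (G : SimpleGraph V) [DecidableRel G.Adj] (u₀ m : ℕ) : Prop :=
  ∀ U : Finset V, u₀ ≤ U.card → 16 * (univ.filter fun v => (nbrIn G v U).card < 4 * m).card ≤ m

lemma exists_path_between {u₀ m : ℕ} (hE : JoinsLarge G m) (hLow : ReachesLarge G u₀ m)
    (hm : 1 ≤ m) (k : ℕ) (A B U : Finset V) (hA : m ≤ A.card) (hB : m ≤ B.card)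
    (hU : u₀ + k ≤ U.card) (hAB : Disjoint A B) (hUB : Disjoint U B) :
    ∃ a ∈ A, ∃ b ∈ B, ∃ mid : List V, mid.length = k ∧ (∀ x ∈ mid, x ∈ U) ∧
      (a :: (mid ++ [b])).Nodup ∧ (a :: (mid ++ [b])).IsChain G.Adj := by
  induction k generalizing A U with
  | zero =>
    obtain ⟨a, ha, b, hb, hab⟩ := hE A B hA hB
    exact ⟨a, ha, b, hb, [], rfl, by simp, by simpa using hab.ne, by simpa using hab⟩
  | succ k ih =>
    obtain ⟨a, ha, hlow⟩ : ∃ a ∈ A, 4 * m ≤ (nbrIn G a U).card := by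
      by_contra! hcon
      have h1 : A ⊆ univ.filter fun v => (nbrIn G v U).card < 4 * m := fun a ha =>
        mem_filter.mpr ⟨mem_univ _, hcon a ha⟩
      have h2 := card_le_card h1
      have h3 := hLow U (by omega)
      omega
    have hUe : U.card - 1 ≤ (U.erase a).card := pred_card_le_card_erase
    have hN : (nbrIn G a U) ⊆ U.erase a := fun x hx => by
      obtain ⟨h1, h2⟩ := mem_nbrIn.mp hx
      exact mem_erase.mpr ⟨h2.ne', h1⟩
    have hsub : U.erase a ⊆ U := erase_subset _ _
    obtain ⟨a', ha', b, hb, mid, hlen, hmid, hnd, hch⟩ := ih (nbrIn G a U) (U.erase a) (by omega)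
      (by omega) (disjoint_of_subset_left (hN.trans hsub) hUB) (disjoint_of_subset_left hsub hUB)
    refine ⟨a, ha, b, hb, a' :: mid, by simp [hlen], ?_, ?_, ?_⟩
    · intro x hx
      rcases List.mem_cons.mp hx with rfl | hx
      · exact hsub (hN ha')
      · exact hsub (hmid x hx)
    · rw [List.cons_append, List.nodup_cons]
      refine ⟨?_, hnd⟩
      intro hmem
      rcases List.mem_cons.mp hmem with rfl | hmem
      · exact notMem_erase _ _ (hN ha')
      rcases List.mem_append.mp hmem with h | h
      · exact notMem_erase _ _ (hmid _ h)
      · rw [List.mem_singleton] at h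
        exact disjoint_left.mp hAB ha (h ▸ hb)
    · rw [List.cons_append, List.isChain_cons_cons]
      exact ⟨(mem_nbrIn.mp ha').2, hch⟩

/-- The lists `c b`, for `b ∈ T`, are the interiors of disjoint paths from `a b` to `t b`. -/
def IsConn (G : SimpleGraph V) (a t : β → V) (g : β → ℕ) (T : Finset β) (c : β → List V) : Prop :=
  (∀ b ∈ T, (c b).length = g b ∧ (c b).Nodup ∧ (a b :: (c b ++ [t b])).IsChain G.Adj) ∧
  ∀ b ∈ T, ∀ b' ∈ T, b ≠ b' → ∀ x ∈ c b, x ∉ c b'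

/-- All vertices on the lists `c b` with `b ∈ T`. -/
def listUnion (c : β → List V) (T : Finset β) : Finset V := T.biUnion fun b => (c b).toFinset

lemma mem_listUnion {c : β → List V} {T : Finset β} {x : V} :
    x ∈ listUnion c T ↔ ∃ b ∈ T, x ∈ c b := by
  simp [listUnion]

lemma IsConn.card_listUnion_le {a t : β → V} {g : β → ℕ} {T : Finset β} {c : β → List V}
    (h : IsConn G a t g T c) : (listUnion c T).card ≤ ∑ b ∈ T, g b := by
  refine card_biUnion_le.trans (sum_le_sum fun b hb => ?_)
  rw [← (h.1 b hb).1]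
  exact List.toFinset_card_le _

lemma IsConn.union {a t : β → V} {g : β → ℕ} {T₁ T₂ : Finset β} {c₁ c₂ : β → List V}
    (h₁ : IsConn G a t g T₁ c₁) (h₂ : IsConn G a t g T₂ c₂) (hT : Disjoint T₁ T₂)
    (hd : Disjoint (listUnion c₁ T₁) (listUnion c₂ T₂)) :
    ∃ c, IsConn G a t g (T₁ ∪ T₂) c ∧
      listUnion c (T₁ ∪ T₂) = listUnion c₁ T₁ ∪ listUnion c₂ T₂ := by
  let c : β → List V := fun b => if b ∈ T₁ then c₁ b else c₂ b
  have e₁ : ∀ b ∈ T₁, c b = c₁ b := fun b hb => if_pos hb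
  have e₂ : ∀ b ∈ T₂, c b = c₂ b := fun b hb => if_neg fun h => disjoint_left.mp hT h hb
  have hcross : ∀ b ∈ T₁, ∀ b' ∈ T₂, ∀ x ∈ c₁ b, x ∉ c₂ b' := fun b hb b' hb' x hx hx' =>
    disjoint_left.mp hd (mem_listUnion.mpr ⟨b, hb, hx⟩) (mem_listUnion.mpr ⟨b', hb', hx'⟩)
  refine ⟨c, ⟨?_, ?_⟩, ?_⟩
  · intro b hb
    rcases mem_union.mp hb with hb | hb
    · rw [e₁ b hb]; exact h₁.1 b hb
    · rw [e₂ b hb]; exact h₂.1 b hb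
  · intro b hb b' hb' hne x hx
    rcases mem_union.mp hb with hb | hb <;> rcases mem_union.mp hb' with hb' | hb'
    · rw [e₁ b hb] at hx; rw [e₁ b' hb']; exact h₁.2 b hb b' hb' hne x hx
    · rw [e₁ b hb] at hx; rw [e₂ b' hb']; exact hcross b hb b' hb' x hx
    · rw [e₂ b hb] at hx; rw [e₁ b' hb']; exact fun hx' => hcross b' hb' b hb x hx' hx
    · rw [e₂ b hb] at hx; rw [e₂ b' hb']; exact h₂.2 b hb b' hb' hne x hx
  · ext x
    simp only [mem_union, mem_listUnion]
    constructor
    · rintro ⟨b, hb | hb, hx⟩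
      · exact Or.inl ⟨b, hb, e₁ b hb ▸ hx⟩
      · exact Or.inr ⟨b, hb, e₂ b hb ▸ hx⟩
    · rintro (⟨b, hb, hx⟩ | ⟨b, hb, hx⟩)
      · exact ⟨b, Or.inl hb, (e₁ b hb).symm ▸ hx⟩
      · exact ⟨b, Or.inr hb, (e₂ b hb).symm ▸ hx⟩

lemma isConn_empty (a t : β → V) (g : β → ℕ) (c : β → List V) : IsConn G a t g ∅ c :=
  ⟨by simp, by simp⟩

lemma isConn_singleton {a t : β → V} {g : β → ℕ} {b : β} {L : List V} (h1 : L.length = g b)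
    (h2 : L.Nodup) (h3 : (a b :: (L ++ [t b])).IsChain G.Adj) :
    IsConn G a t g {b} fun _ => L := by
  refine ⟨fun b' hb' => ?_, fun b₁ h₁ b₂ h₂ hne => ?_⟩
  · rw [mem_singleton] at hb'
    subst hb'
    exact ⟨h1, h2, h3⟩
  · rw [mem_singleton] at h₁ h₂
    exact absurd (h₁.trans h₂.symm) hne

/-- A single connection whose first and last vertices lie in `K` and whose middle lies in `U`. -/
lemma exists_single_conn {u₀ m : ℕ} (hE : JoinsLarge G m) (hLow : ReachesLarge G u₀ m)
    (hm : 1 ≤ m) {x y : V} {k : ℕ} {K U : Finset V} (hx : 2 * m ≤ (nbrIn G x K).card)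
    (hy : 2 * m ≤ (nbrIn G y K).card) (hU : u₀ + m + k ≤ U.card) :
    ∃ a ∈ K, ∃ b ∈ K, ∃ mid : List V, mid.length = k ∧ (∀ z ∈ mid, z ∈ U) ∧
      (a :: (mid ++ [b])).Nodup ∧ (x :: ((a :: (mid ++ [b])) ++ [y])).IsChain G.Adj := by
  obtain ⟨B, hB, hBm⟩ := exists_subset_card_eq (show m ≤ (nbrIn G y K).card by omega)
  have hA : m ≤ (nbrIn G x K \ B).card := by
    have := le_card_sdiff B (nbrIn G x K)
    omega
  have hUB : u₀ + k ≤ (U \ B).card := by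
    have := le_card_sdiff B U
    omega
  obtain ⟨a, ha, b, hb, mid, h1, h2, h3, h4⟩ := exists_path_between hE hLow hm k _ B (U \ B) hA
    hBm.ge hUB sdiff_disjoint sdiff_disjoint
  have ha' := mem_nbrIn.mp (mem_sdiff.mp ha).1
  have hb' := mem_nbrIn.mp (hB hb)
  refine ⟨a, ha'.1, b, hb'.1, mid, h1, fun z hz => (mem_sdiff.mp (h2 z hz)).1, h3, ?_⟩
  rw [List.cons_append, List.isChain_cons_cons]
  refine ⟨ha'.2, ?_⟩
  rw [← List.cons_append, List.isChain_append]
  refine ⟨h4, by simp, ?_⟩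
  intro p hp q hq
  obtain rfl : y = q := by simpa using hq
  obtain rfl : b = p := by
    rw [← List.cons_append, List.getLast?_concat] at hp
    simpa using hp
  exact hb'.2.symm

/-- A few pairs can be connected through a reserve `K` in which all their ends have many
neighbours. -/
lemma exists_conn_reserve {u₀ m : ℕ} (hE : JoinsLarge G m) (hLow : ReachesLarge G u₀ m)
    (hm : 1 ≤ m) (a t : β → V) (g : β → ℕ) (K R : Finset V) (hKR : Disjoint K R) (T : Finset β)
    (hg : ∀ b ∈ T, 2 ≤ g b) (hT : T.card ≤ m)
    (ha : ∀ b ∈ T, 4 * m ≤ (nbrIn G (a b) K).card) (ht : ∀ b ∈ T, 4 * m ≤ (nbrIn G (t b) K).card)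
    (hR : u₀ + m + ∑ b ∈ T, g b ≤ R.card) :
    ∃ c, IsConn G a t g T c ∧ listUnion c T ⊆ K ∪ R ∧ (listUnion c T ∩ K).card ≤ 2 * T.card := by
  induction T using Finset.induction_on with
  | empty => exact ⟨fun _ => [], isConn_empty a t g _, by simp [listUnion], by simp [listUnion]⟩
  | insert b T hb ih =>
    rw [card_insert_of_notMem hb] at hT
    rw [sum_insert hb] at hR
    obtain ⟨c, hc, hsub, hcK⟩ := ih (fun x hx => hg x (mem_insert_of_mem hx)) (by omega)
      (fun x hx => ha x (mem_insert_of_mem hx)) (fun x hx => ht x (mem_insert_of_mem hx)) (by omega)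
    set Z := listUnion c T with hZ
    have hnb : ∀ v, 4 * m ≤ (nbrIn G v K).card → 2 * m ≤ (nbrIn G v (K \ Z)).card := by
      intro v hv
      have h1 : nbrIn G v K \ (Z ∩ K) ⊆ nbrIn G v (K \ Z) := by
        intro w hw
        obtain ⟨h1, h2⟩ := mem_sdiff.mp hw
        obtain ⟨h3, h4⟩ := mem_nbrIn.mp h1
        exact mem_nbrIn.mpr ⟨mem_sdiff.mpr ⟨h3, fun h => h2 (mem_inter.mpr ⟨h, h3⟩)⟩, h4⟩
      have h2 := card_le_card h1
      have h3 := le_card_sdiff (Z ∩ K) (nbrIn G v K)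
      omega
    have hgb := hg b (mem_insert_self _ _)
    have hRZ : u₀ + m + (g b - 2) ≤ (R \ Z).card := by
      have h1 := hc.card_listUnion_le
      have h2 := le_card_sdiff Z R
      rw [← hZ] at h1
      omega
    obtain ⟨p, hp, q, hq, mid, h1, h2, h3, h4⟩ := exists_single_conn hE hLow hm
      (hnb _ (ha b (mem_insert_self _ _))) (hnb _ (ht b (mem_insert_self _ _))) hRZ
    have hs := isConn_singleton (g := g) (b := b) (L := p :: (mid ++ [q]))
      (by simp only [List.length_cons, List.length_append, List.length_nil]; omega) h3 h4
    have hlu : listUnion (fun _ : β => p :: (mid ++ [q])) {b} = insert p (insert q mid.toFinset) := by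
      ext x; simp [listUnion]
    have hmidR : ∀ x ∈ mid, x ∈ R ∧ x ∉ Z := fun x hx => mem_sdiff.mp (h2 x hx)
    obtain ⟨hpK, hpZ⟩ := mem_sdiff.mp hp
    obtain ⟨hqK, hqZ⟩ := mem_sdiff.mp hq
    obtain ⟨c', hc', hu⟩ := hs.union hc (disjoint_singleton_left.mpr hb) (by
      rw [hlu, disjoint_left]
      intro x hx
      simp only [mem_insert, List.mem_toFinset] at hx
      rcases hx with rfl | rfl | hx
      · exact hpZ
      · exact hqZ
      · exact (hmidR x hx).2)
    rw [hlu, ← insert_eq] at hu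
    rw [← insert_eq] at hc'
    refine ⟨c', hc', ?_, ?_⟩
    · rw [hu]
      intro x hx
      simp only [mem_union, mem_insert, List.mem_toFinset] at hx
      rcases hx with (rfl | rfl | hx) | hx
      · exact mem_union_left _ hpK
      · exact mem_union_left _ hqK
      · exact mem_union_right _ (hmidR x hx).1
      · exact hsub hx
    · rw [hu, card_insert_of_notMem hb]
      have : (insert p (insert q mid.toFinset) ∪ listUnion c T) ∩ K ⊆ {p, q} ∪ (Z ∩ K) := by
        intro x hx
        simp only [mem_inter, mem_union, mem_insert, List.mem_toFinset, mem_singleton] at hx ⊢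
        obtain ⟨(rfl | rfl | hx) | hx, hxK⟩ := hx
        · simp
        · simp
        · exact absurd (hmidR x hx).1 (disjoint_left.mp hKR hxK)
        · exact Or.inr ⟨hx, hxK⟩
      have h5 := (card_le_card this).trans (card_union_le _ _)
      have h6 : ({p, q} : Finset V).card ≤ 2 := card_le_two
      omega

/-- All but a few pairs can be connected greedily inside a large set `R`. -/
lemma exists_conn_greedy {u₀ m : ℕ} (hE : JoinsLarge G m) (hLow : ReachesLarge G u₀ m)
    (hm : 1 ≤ m) (a t : β → V) (g : β → ℕ) (R : Finset V) (T : Finset β)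
    (haT : Set.InjOn a T) (htT : Set.InjOn t T) (hg : ∀ b ∈ T, 2 ≤ g b)
    (hR : u₀ + m + ∑ b ∈ T, g b ≤ R.card) :
    ∃ T₁ ⊆ T, ∃ c, IsConn G a t g T₁ c ∧ listUnion c T₁ ⊆ R ∧ 8 * (T \ T₁).card ≤ m := by
  classical
  obtain ⟨T₁, hT₁, hmax⟩ := exists_max_image
    (T.powerset.filter fun T₁ => ∃ c, IsConn G a t g T₁ c ∧ listUnion c T₁ ⊆ R) card
    ⟨∅, mem_filter.mpr ⟨empty_mem_powerset _, fun _ => [], isConn_empty a t g _,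
      by simp [listUnion]⟩⟩
  obtain ⟨hsub, c, hc, hcR⟩ := mem_filter.mp hT₁
  rw [mem_powerset] at hsub
  refine ⟨T₁, hsub, c, hc, hcR, ?_⟩
  set U := R \ listUnion c T₁ with hU
  have hUc : u₀ + m + ∑ b ∈ T \ T₁, g b ≤ U.card := by
    have h1 := hc.card_listUnion_le
    have h2 := le_card_sdiff (listUnion c T₁) R
    have h3 := sum_sdiff (f := g) hsub
    rw [← hU] at h2
    omega
  set L := univ.filter fun v => (nbrIn G v U).card < 4 * m with hL
  have hLm : 16 * L.card ≤ m := hLow U (by omega)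
  have hstuck : ∀ b ∈ T \ T₁, a b ∈ L ∨ t b ∈ L := by
    intro b hb
    by_contra! hcon
    simp only [hL, mem_filter, mem_univ, true_and, not_lt] at hcon
    obtain ⟨hbT, hbT₁⟩ := mem_sdiff.mp hb
    have h1 : g b ≤ ∑ b ∈ T \ T₁, g b := single_le_sum (fun _ _ => Nat.zero_le _) hb
    have hgb := hg b hbT
    obtain ⟨p, hp, q, hq, mid, h1, h2, h3, h4⟩ := exists_single_conn hE hLow hm
      (k := g b - 2) (show 2 * m ≤ (nbrIn G (a b) U).card by omega)
      (show 2 * m ≤ (nbrIn G (t b) U).card by omega) (show _ ≤ U.card by omega)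
    have hs := isConn_singleton (g := g) (b := b) (L := p :: (mid ++ [q]))
      (by simp only [List.length_cons, List.length_append, List.length_nil]; omega) h3 h4
    have hall : ∀ x ∈ listUnion (fun _ : β => p :: (mid ++ [q])) {b}, x ∈ U := by
      intro x hx
      simp only [listUnion, mem_biUnion, mem_singleton, List.mem_toFinset, List.mem_cons,
        List.mem_append, exists_eq_left, List.not_mem_nil, or_false] at hx
      rcases hx with rfl | hx | rfl
      · exact hp
      · exact h2 x hx
      · exact hq
    obtain ⟨c', hc', hu⟩ := hs.union hc (disjoint_singleton_left.mpr hbT₁) (by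
      rw [disjoint_left]
      exact fun x hx => (mem_sdiff.mp (hall x hx)).2)
    rw [← insert_eq] at hc' hu
    have := hmax (insert b T₁) (mem_filter.mpr ⟨mem_powerset.mpr (insert_subset hbT hsub), c', hc',
      by
        rw [hu]
        exact union_subset (fun x hx => (mem_sdiff.mp (hall x hx)).1) hcR⟩)
    rw [card_insert_of_notMem hbT₁] at this
    omega
  have hcover : T \ T₁ ⊆ ((T \ T₁).filter fun b => a b ∈ L) ∪ (T \ T₁).filter fun b => t b ∈ L := by
    intro b hb
    rcases hstuck b hb with h | h
    · exact mem_union_left _ (mem_filter.mpr ⟨hb, h⟩)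
    · exact mem_union_right _ (mem_filter.mpr ⟨hb, h⟩)
  have hinj : ∀ f : β → V, Set.InjOn f T → ((T \ T₁).filter fun b => f b ∈ L).card ≤ L.card := by
    intro f hf
    refine card_le_card_of_injOn f (fun b hb => (mem_filter.mp hb).2) (hf.mono ?_)
    intro b hb
    exact (mem_sdiff.mp (mem_filter.mp hb).1).1
  have h1 := (card_le_card hcover).trans (card_union_le _ _)
  have h2 := hinj a haT
  have h3 := hinj t htT
  omega

end Connecting

section Assembly

variable {V β : Type} [Fintype V] [DecidableEq V] [Fintype β] [DecidableEq β] {G : SimpleGraph V}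
  [DecidableRel G.Adj]

lemma exists_injOn_of_card_le {α γ : Type*} [DecidableEq α] [DecidableEq γ] [Nonempty γ]
    (A : Finset α) (B : Finset γ) (h : A.card ≤ B.card) :
    ∃ φ : α → γ, Set.InjOn φ A ∧ ∀ a ∈ A, φ a ∈ B := by
  obtain ⟨φ, h1, h2⟩ := exists_injOn_of_hall (fun (_ : α) (_ : γ) => True) A B (by
    intro S hS
    rcases S.eq_empty_or_nonempty with rfl | ⟨a, ha⟩
    · simp
    · rw [filter_true_of_mem fun b _ => ⟨a, ha, trivial⟩]
      exact (card_le_card hS).trans h)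
  exact ⟨φ, h1, fun a ha => (h2 a ha).1⟩

lemma isBlockFamily_of_conn {s g : β → ℕ} {next : β → β} {E₀ : Finset V} (pre : β → List V)
    (out inn : β → V) (conn : β → List V)
    (hconn : IsConn G out (fun b => inn (next b)) g univ conn)
    (hlen : ∀ b, (pre b).length + 1 + g b = s b)
    (hch : ∀ b, (pre b ++ [out b]).IsChain G.Adj) (hnd : ∀ b, (pre b ++ [out b]).Nodup)
    (hhead : ∀ b, (pre b ++ [out b]).head? = some (inn b))
    (hdis : ∀ b b', b ≠ b' → ∀ x ∈ pre b ++ [out b], x ∉ pre b' ++ [out b'])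
    (hcr : ∀ b b', ∀ x ∈ pre b ++ [out b], x ∉ conn b')
    (hE : ∀ b, ∀ x ∈ pre b ++ [out b], x ∉ E₀) (hE' : ∀ b, ∀ x ∈ conn b, x ∉ E₀) :
    IsBlockFamily G s next E₀ fun b => (pre b ++ [out b]) ++ conn b := by
  have hfull : ∀ b, (((pre b ++ [out b]) ++ conn b) ++ [inn (next b)]).IsChain G.Adj := by
    intro b
    have h1 := (hconn.1 b (mem_univ b)).2.2
    have h2 := hch b
    rw [List.append_assoc, List.append_assoc]
    rw [List.isChain_append] at h2 ⊢
    refine ⟨h2.1, h1, ?_⟩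
    simpa using h2.2.2
  refine ⟨?_, ?_, ?_, ?_, ?_, ?_⟩
  · intro b
    have h1 := (hconn.1 b (mem_univ b)).1
    have h2 := hlen b
    simp only [List.length_append, List.length_cons, List.length_nil]
    omega
  · intro b
    rw [List.nodup_append]
    refine ⟨hnd b, (hconn.1 b (mem_univ b)).2.1, ?_⟩
    rintro x hx y hy rfl
    exact hcr b b x hx hy
  · intro b
    exact (List.isChain_append.mp (hfull b)).1
  · intro b x hx y hy
    have hy' : y = inn (next b) := by
      have h1 : ((pre (next b) ++ [out (next b)]) ++ conn (next b)).head? =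
          some (inn (next b)) := by
        rw [List.head?_append, hhead]; rfl
      rw [h1] at hy
      exact (Option.some.inj hy).symm
    exact (List.isChain_append.mp (hfull b)).2.2 x hx y (by simp [hy'])
  · intro b b' hne x hx hx'
    rcases List.mem_append.mp hx with hx | hx <;> rcases List.mem_append.mp hx' with hx' | hx'
    · exact hdis b b' hne x hx hx'
    · exact hcr b b' x hx hx'
    · exact hcr b' b x hx' hx
    · exact hconn.2 b (mem_univ b) b' (mem_univ b') hne x hx hx'
  · intro b x hx
    rcases List.mem_append.mp hx with hx | hx
    · exact hE b x hx
    · exact hE' b x hx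

/-- The vertices of a triangle. -/
def slotSet (t : V × V × V) : Finset V := {t.1, t.2.1, t.2.2}

lemma IsConn.congr {a a' t t' : β → V} {g : β → ℕ} {T : Finset β} {c : β → List V}
    (h : IsConn G a t g T c) (ha : ∀ b ∈ T, a' b = a b) (ht : ∀ b ∈ T, t' b = t b) :
    IsConn G a' t' g T c :=
  ⟨fun b hb => by rw [ha b hb, ht b hb]; exact h.1 b hb, h.2⟩

end Assembly

section Connections

variable {V β : Type} [Fintype V] [DecidableEq V] [Fintype β] [DecidableEq β] {G : SimpleGraph V}
  [DecidableRel G.Adj]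

lemma le_card_nbrIn_of_subset {v : V} {A B K : Finset V} {a b : ℕ} (hA : a + b ≤ (nbrIn G v A).card)
    (hB : B.card ≤ b) (hK : A \ B ⊆ K) : a ≤ (nbrIn G v K).card := by
  have h1 : nbrIn G v A \ B ⊆ nbrIn G v K := fun x hx => by
    obtain ⟨hx1, hx2⟩ := mem_sdiff.mp hx
    rw [mem_nbrIn] at hx1 ⊢
    exact ⟨hK (mem_sdiff.mpr ⟨hx1.1, hx2⟩), hx1.2⟩
  have h2 := card_le_card h1
  have h3 := le_card_sdiff B (nbrIn G v A)
  omega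

/-- Connecting all pairs of ends, where the ends `f₀ b` with `b ∈ I'` may be moved when they are
used by a connection. -/
lemma exists_conn_moving [Nonempty V] {u₀ m : ℕ} (hE : JoinsLarge G m) (hLow : ReachesLarge G u₀ m)
    (hm : 1 ≤ m) (C F R₀ : Finset V)
    (hS : 16 * (univ.filter fun v => 20 * m ≤ (nbrIn G v F).card).card ≤ m)
    (hC : ∀ v, 40 * m ≤ (nbrIn G v C).card) (next : β → β) (hnext : Function.Injective next)
    (g : β → ℕ) (I' : Finset β) (e₁ e₂ f₀ : β → V)
    (hinj₁ : Function.Injective fun b => if b ∈ I' then f₀ b else e₁ b)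
    (hinj₂ : Function.Injective fun b => if b ∈ I' then f₀ b else e₂ b)
    (T : Finset β) (hg : ∀ b ∈ T, 2 ≤ g b) (hRC : Disjoint R₀ C)
    (hf₀R : ∀ b ∈ I', f₀ b ∉ R₀) (hf₀C : ∀ b ∈ I', f₀ b ∈ C → f₀ b ∈ F)
    (he₁ : ∀ b ∉ I', e₁ b ∉ R₀) (he₂ : ∀ b ∉ I', e₂ b ∉ R₀)
    (hR : u₀ + 2 * m + ∑ b ∈ T, g b ≤ R₀.card) :
    ∃ (f : β → V) (c : β → List V), Set.InjOn f I' ∧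
      IsConn G (fun b => if b ∈ I' then f b else e₁ b)
        (fun b => if next b ∈ I' then f (next b) else e₂ (next b)) g T c ∧
      listUnion c T ⊆ C ∪ R₀ ∧ (∀ b ∈ I', f b ∉ listUnion c T) ∧
      ∀ b ∈ I', f b = f₀ b ∨ (f b ∈ R₀ ∧ f₀ b ∈ listUnion c T) := by
  set out₀ : β → V := fun b => if b ∈ I' then f₀ b else e₁ b with hout₀
  set inn₀ : β → V := fun b => if b ∈ I' then f₀ b else e₂ b with hinn₀
  set S : Finset V := univ.filter fun v => 20 * m ≤ (nbrIn G v F).card with hSdef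
  have hf₀inj : Set.InjOn f₀ I' := fun a ha b hb h => hinj₁ (by
    rw [mem_coe] at ha hb
    simp only [hout₀, if_pos ha, if_pos hb, h])
  set B₀ := T.filter fun b => out₀ b ∈ S ∨ inn₀ (next b) ∈ S with hB₀
  have hB₀T : B₀ ⊆ T := filter_subset _ _
  have hB₀card : B₀.card ≤ 2 * S.card := by
    have h1 : (T.filter fun b => out₀ b ∈ S).card ≤ S.card :=
      card_le_card_of_injOn out₀ (fun b hb => (mem_filter.mp hb).2) hinj₁.injOn
    have h2 : (T.filter fun b => inn₀ (next b) ∈ S).card ≤ S.card :=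
      card_le_card_of_injOn (fun b => inn₀ (next b)) (fun b hb => (mem_filter.mp hb).2)
        (hinj₂.comp hnext).injOn
    have h3 := card_union_le (T.filter fun b => out₀ b ∈ S) (T.filter fun b => inn₀ (next b) ∈ S)
    rw [← filter_or, ← hB₀] at h3
    omega
  set Q := B₀.image out₀ ∪ B₀.image (fun b => inn₀ (next b)) with hQ
  have hQcard : Q.card ≤ 2 * B₀.card := by
    have h1 : (B₀.image out₀).card ≤ _ := card_image_le
    have h2 : (B₀.image fun b => inn₀ (next b)).card ≤ _ := card_image_le
    have h3 : Q.card ≤ _ := card_union_le _ _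
    omega
  have hsub : ∑ b ∈ T \ B₀, g b + ∑ b ∈ B₀, g b = ∑ b ∈ T, g b := sum_sdiff hB₀T
  obtain ⟨c₀, hc₀, hc₀U, hc₀K⟩ := exists_conn_reserve hE hLow hm out₀ (fun b => inn₀ (next b)) g
    (C \ Q) R₀ (hRC.symm.mono_left sdiff_subset) B₀ (fun b hb => hg b (hB₀T hb)) (by omega)
    (fun b _ => le_card_nbrIn_of_subset (b := 36 * m) (by have := hC (out₀ b); omega) (by omega)
      subset_rfl)
    (fun b _ => le_card_nbrIn_of_subset (b := 36 * m)
      (by have := hC (inn₀ (next b)); omega) (by omega) subset_rfl) (by omega)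
  set U₀ := listUnion c₀ B₀ with hU₀
  have hU₀card : U₀.card ≤ ∑ b ∈ B₀, g b := hc₀.card_listUnion_le
  have hU₀C : (U₀ ∩ C).card ≤ 2 * B₀.card := by
    refine le_trans (card_le_card fun x hx => ?_) hc₀K
    obtain ⟨hx1, hx2⟩ := mem_inter.mp hx
    refine mem_inter.mpr ⟨hx1, ?_⟩
    rcases mem_union.mp (hc₀U hx1) with h | h
    · exact h
    · exact absurd hx2 (disjoint_left.mp hRC h)
  set D := I'.filter fun b => f₀ b ∈ U₀ with hD
  have hDcard : D.card ≤ 2 * B₀.card := by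
    refine le_trans (card_le_card_of_injOn f₀ (fun b hb => ?_) fun a ha b hb h => ?_) hU₀C
    · obtain ⟨hb1, hb2⟩ := mem_filter.mp hb
      refine mem_coe.mpr (mem_inter.mpr ⟨hb2, ?_⟩)
      rcases mem_union.mp (hc₀U hb2) with h | h
      · exact (mem_sdiff.mp h).1
      · exact absurd h (hf₀R b hb1)
    · exact hf₀inj (mem_filter.mp ha).1 (mem_filter.mp hb).1 h
  have hfresh : R₀.card ≤ ((R₀ \ U₀) \ S).card + U₀.card + S.card := by
    have h1 := le_card_sdiff U₀ R₀
    have h2 := le_card_sdiff S (R₀ \ U₀)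
    omega
  obtain ⟨h, hhinj, hh⟩ := exists_injOn_of_card_le D ((R₀ \ U₀) \ S) (by omega)
  have hhR : ∀ b ∈ D, h b ∈ R₀ ∧ h b ∉ U₀ ∧ h b ∉ S := fun b hb => by
    have := hh b hb
    simp only [mem_sdiff] at this
    exact ⟨this.1.1, this.1.2, this.2⟩
  set f : β → V := fun b => if b ∈ D then h b else f₀ b with hf
  have hfD : ∀ b ∈ D, f b = h b := fun b hb => if_pos hb
  have hfD' : ∀ b ∉ D, f b = f₀ b := fun b hb => if_neg hb
  have hDI : D ⊆ I' := filter_subset _ _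
  have hfinj : Set.InjOn f I' := by
    intro a ha b hb hab
    by_cases haD : a ∈ D <;> by_cases hbD : b ∈ D
    · rw [hfD a haD, hfD b hbD] at hab
      exact hhinj haD hbD hab
    · rw [hfD a haD, hfD' b hbD] at hab
      exact absurd (hab ▸ (hhR a haD).1) (hf₀R b hb)
    · rw [hfD' a haD, hfD b hbD] at hab
      exact absurd (hab ▸ (hhR b hbD).1) (hf₀R a ha)
    · rw [hfD' a haD, hfD' b hbD] at hab
      exact hf₀inj ha hb hab
  have hinj' : ∀ e : β → V, Function.Injective (fun b => if b ∈ I' then f₀ b else e b) →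
      (∀ b ∉ I', e b ∉ R₀) → Function.Injective fun b => if b ∈ I' then f b else e b := by
    intro e he heR
    have key : ∀ a ∈ I', ∀ b ∉ I', f a ≠ e b := by
      intro a ha b hb hab
      by_cases haD : a ∈ D
      · rw [hfD a haD] at hab
        exact heR b hb (hab ▸ (hhR a haD).1)
      · rw [hfD' a haD] at hab
        have : a = b := he (by simp only [if_pos ha, if_neg hb, hab])
        exact hb (this ▸ ha)
    intro a b hab
    by_cases ha : a ∈ I' <;> by_cases hb : b ∈ I'
    · simp only [if_pos ha, if_pos hb] at hab
      exact hfinj ha hb hab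
    · simp only [if_pos ha, if_neg hb] at hab
      exact absurd hab (key a ha b hb)
    · simp only [if_neg ha, if_pos hb] at hab
      exact absurd hab.symm (key b hb a ha)
    · simp only [if_neg ha, if_neg hb] at hab
      exact he (by simp only [if_neg ha, if_neg hb, hab])
  set out : β → V := fun b => if b ∈ I' then f b else e₁ b with hout
  set inn : β → V := fun b => if b ∈ I' then f b else e₂ b with hinn
  have houtinj : Function.Injective out := hinj' e₁ hinj₁ he₁
  have hinninj : Function.Injective inn := hinj' e₂ hinj₂ he₂
  have hnotD : ∀ b ∈ I', f₀ b ∈ Q → b ∉ D := by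
    intro b hb hbQ hbD
    rcases mem_union.mp (hc₀U (mem_filter.mp hbD).2) with h | h
    · exact (mem_sdiff.mp h).2 hbQ
    · exact hf₀R b hb h
  have hout₀eq : ∀ b ∈ B₀, out b = out₀ b := by
    intro b hb
    by_cases hbI : b ∈ I'
    · have h1 : out₀ b ∈ Q := mem_union_left _ (mem_image_of_mem _ hb)
      simp only [hout₀, if_pos hbI] at h1
      simp only [hout, hout₀, if_pos hbI]
      exact hfD' b (hnotD b hbI h1)
    · simp only [hout, hout₀, if_neg hbI]
  have hinn₀eq : ∀ b ∈ B₀, inn (next b) = inn₀ (next b) := by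
    intro b hb
    by_cases hbI : next b ∈ I'
    · have h1 : inn₀ (next b) ∈ Q :=
        mem_union_right _ (mem_image_of_mem (fun b => inn₀ (next b)) hb)
      simp only [hinn₀, if_pos hbI] at h1
      simp only [hinn, hinn₀, if_pos hbI]
      exact hfD' _ (hnotD _ hbI h1)
    · simp only [hinn, hinn₀, if_neg hbI]
  have houtS : ∀ b ∈ T \ B₀, out b ∉ S := by
    intro b hb hbS
    obtain ⟨hb1, hb2⟩ := mem_sdiff.mp hb
    have hb3 : out₀ b ∉ S := fun h' => hb2 (mem_filter.mpr ⟨hb1, Or.inl h'⟩)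
    by_cases hbD : b ∈ D
    · simp only [hout, if_pos (hDI hbD), hfD b hbD] at hbS
      exact (hhR b hbD).2.2 hbS
    · have : out b = out₀ b := by simp only [hout, hout₀, hfD' b hbD]
      exact hb3 (this ▸ hbS)
  have hinnS : ∀ b ∈ T \ B₀, inn (next b) ∉ S := by
    intro b hb hbS
    obtain ⟨hb1, hb2⟩ := mem_sdiff.mp hb
    have hb3 : inn₀ (next b) ∉ S := fun h' => hb2 (mem_filter.mpr ⟨hb1, Or.inr h'⟩)
    by_cases hbD : next b ∈ D
    · simp only [hinn, if_pos (hDI hbD), hfD _ hbD] at hbS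
      exact (hhR _ hbD).2.2 hbS
    · have : inn (next b) = inn₀ (next b) := by simp only [hinn, hinn₀, hfD' _ hbD]
      exact hb3 (this ▸ hbS)
  have hc₀' : IsConn G out (fun b => inn (next b)) g B₀ c₀ := hc₀.congr hout₀eq hinn₀eq
  set R := (R₀ \ U₀) \ D.image h with hRdef
  have hRcard : R₀.card ≤ R.card + U₀.card + 2 * B₀.card := by
    have h1 := le_card_sdiff U₀ R₀
    have h2 := le_card_sdiff (D.image h) (R₀ \ U₀)
    rw [← hRdef] at h2
    have h3 : (D.image h).card ≤ D.card := card_image_le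
    omega
  have hRR₀ : R ⊆ R₀ := sdiff_subset.trans sdiff_subset
  obtain ⟨T₁, hT₁, c₁, hc₁, hc₁U, hrest⟩ := exists_conn_greedy hE hLow hm out
    (fun b => inn (next b)) g R (T \ B₀) houtinj.injOn (hinninj.comp hnext).injOn
    (fun b hb => hg b (mem_sdiff.mp hb).1) (by omega)
  set U₁ := listUnion c₁ T₁ with hU₁
  have hU₁card : U₁.card ≤ ∑ b ∈ T₁, g b := hc₁.card_listUnion_le
  have hsub₁ : ∑ b ∈ (T \ B₀) \ T₁, g b + ∑ b ∈ T₁, g b = ∑ b ∈ T \ B₀, g b := sum_sdiff hT₁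
  have hR₂card := le_card_sdiff U₁ R
  have hK₂ : ∀ v ∉ S, 4 * m ≤ (nbrIn G v ((C \ F) \ U₀)).card := by
    intro v hv
    have h1 : (nbrIn G v F).card < 20 * m := by
      by_contra! h'
      exact hv (mem_filter.mpr ⟨mem_univ _, h'⟩)
    have h2 := hC v
    refine le_card_nbrIn_of_subset (B := nbrIn G v F ∪ (U₀ ∩ C)) (A := nbrIn G v C) (b := 30 * m)
      ?_ ?_ ?_ |>.trans (card_le_card (show nbrIn G v (nbrIn G v ((C \ F) \ U₀)) ⊆ _ from
        nbrIn_subset _ _))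
    · have : nbrIn G v (nbrIn G v C) = nbrIn G v C := by
        ext x; simp only [mem_nbrIn]; tauto
      rw [this]; omega
    · have := card_union_le (nbrIn G v F) (U₀ ∩ C)
      omega
    · intro x hx
      simp only [mem_sdiff, mem_union, mem_nbrIn, mem_inter] at hx ⊢
      tauto
  have hK₂R : Disjoint ((C \ F) \ U₀) (R \ U₁) :=
    hRC.symm.mono (sdiff_subset.trans sdiff_subset) (sdiff_subset.trans hRR₀)
  obtain ⟨c₂, hc₂, hc₂U, -⟩ := exists_conn_reserve hE hLow hm out (fun b => inn (next b)) g
    ((C \ F) \ U₀) (R \ U₁) hK₂R ((T \ B₀) \ T₁)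
    (fun b hb => hg b (mem_sdiff.mp (mem_sdiff.mp hb).1).1) (by omega)
    (fun b hb => hK₂ _ (houtS b (mem_sdiff.mp hb).1))
    (fun b hb => hK₂ _ (hinnS b (mem_sdiff.mp hb).1)) (by omega)
  set U₂ := listUnion c₂ ((T \ B₀) \ T₁) with hU₂
  obtain ⟨c₃, hc₃, hc₃U⟩ := hc₁.union hc₂ disjoint_sdiff (by
    rw [disjoint_left]
    intro x hx hx'
    rcases mem_union.mp (hc₂U hx') with h' | h'
    · exact disjoint_left.mp hRC (hRR₀ (hc₁U hx)) (mem_sdiff.mp (mem_sdiff.mp h').1).1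
    · exact (mem_sdiff.mp h').2 hx)
  rw [union_sdiff_of_subset hT₁] at hc₃ hc₃U
  have hRU₀ : ∀ x ∈ R, x ∉ U₀ := fun x hx => (mem_sdiff.mp (mem_sdiff.mp hx).1).2
  obtain ⟨c, hc, hcU⟩ := hc₀'.union hc₃ disjoint_sdiff (by
    rw [hc₃U, disjoint_left]
    intro x hx hx'
    rcases mem_union.mp hx' with h' | h'
    · exact hRU₀ x (hc₁U h') hx
    · rcases mem_union.mp (hc₂U h') with h' | h'
      · exact (mem_sdiff.mp h').2 hx
      · exact hRU₀ x (mem_sdiff.mp h').1 hx)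
  rw [union_sdiff_of_subset hB₀T] at hc hcU
  rw [hc₃U] at hcU
  refine ⟨f, c, hfinj, hc, ?_, ?_, ?_⟩
  · rw [hcU]
    intro x hx
    rcases mem_union.mp hx with hx | hx
    · exact union_subset_union sdiff_subset subset_rfl (hc₀U hx)
    · rcases mem_union.mp hx with hx | hx
      · exact mem_union_right _ (hRR₀ (hc₁U hx))
      · exact union_subset_union (sdiff_subset.trans sdiff_subset) (sdiff_subset.trans hRR₀)
          (hc₂U hx)
  · intro b hb hbU
    rw [hcU] at hbU
    by_cases hbD : b ∈ D
    · rw [hfD b hbD] at hbU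
      obtain ⟨h1, h2, -⟩ := hhR b hbD
      have h3 : h b ∉ R := fun h' => (mem_sdiff.mp h').2 (mem_image_of_mem _ hbD)
      rcases mem_union.mp hbU with h' | h'
      · exact h2 h'
      · rcases mem_union.mp h' with h' | h'
        · exact h3 (hc₁U h')
        · rcases mem_union.mp (hc₂U h') with h' | h'
          · exact disjoint_left.mp hRC h1 (mem_sdiff.mp (mem_sdiff.mp h').1).1
          · exact h3 (mem_sdiff.mp h').1
    · rw [hfD' b hbD] at hbU
      rcases mem_union.mp hbU with h' | h'
      · exact hbD (mem_filter.mpr ⟨hb, h'⟩)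
      · rcases mem_union.mp h' with h' | h'
        · exact hf₀R b hb (hRR₀ (hc₁U h'))
        · rcases mem_union.mp (hc₂U h') with h' | h'
          · obtain ⟨h1, h2⟩ := mem_sdiff.mp (mem_sdiff.mp h').1
            exact h2 (hf₀C b hb h1)
          · exact hf₀R b hb (hRR₀ (mem_sdiff.mp h').1)
  · intro b hb
    by_cases hbD : b ∈ D
    · right
      rw [hfD b hbD, hcU]
      exact ⟨(hhR b hbD).1, mem_union_left _ (mem_filter.mp hbD).2⟩
    · exact Or.inl (hfD' b hbD)

end Connections

section Filling

variable {V β : Type} [Fintype V] [DecidableEq V] [Fintype β] [DecidableEq β] {G : SimpleGraph V}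
  [DecidableRel G.Adj]

/-- Connections of length at most one inside triangles. -/
lemma isConn_triangles (s g : β → ℕ) (next : β → β) (x y z out inn : β → V) (T : Finset β)
    (hs : ∀ b ∈ T, s b = 3 ∨ s b = 4) (hg : ∀ b ∈ T, g b = s b - 3)
    (hadj : ∀ b ∈ T, G.Adj (x b) (y b) ∧ G.Adj (y b) (z b) ∧ G.Adj (z b) (x b))
    (hz : Set.InjOn z T) (hout : ∀ b ∈ T, out b = y b) (hinn : ∀ b ∈ T, inn (next b) = x b) :
    IsConn G out (fun b => inn (next b)) g T fun b => if s b = 4 then [z b] else [] := by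
  refine ⟨fun b hb => ?_, fun b hb b' hb' hne v hv hv' => ?_⟩
  · obtain ⟨h1, h2, h3⟩ := hadj b hb
    simp only [hout b hb, hinn b hb, hg b hb]
    rcases hs b hb with h | h
    · simp [h, h1.symm]
    · simp [h, h2, h3]
  · by_cases h : s b = 4 <;> by_cases h' : s b' = 4 <;> simp [h, h'] at hv hv'
    exact hne (hz hb hb' (hv ▸ hv'))

theorem exists_blockFamily_of_fill [Nonempty V] {u₀ m : ℕ} (hE : JoinsLarge G m)
    (hLow : ReachesLarge G u₀ m) (hm : 1 ≤ m) (E₀ C X₁ F : Finset V) (J : Finset (V × V × V))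
    (hS : 16 * (univ.filter fun v => 20 * m ≤ (nbrIn G v F).card).card ≤ m)
    (hC : ∀ v, 40 * m ≤ (nbrIn G v C).card) (hCE : Disjoint C E₀)
    (hX₁ : Disjoint X₁ (E₀ ∪ C ∪ F))
    (hadj : ∀ t ∈ J, G.Adj t.1 t.2.1 ∧ G.Adj t.2.1 t.2.2 ∧ G.Adj t.2.2 t.1)
    (hJd : ∀ t ∈ J, ∀ t' ∈ J, t ≠ t' → Disjoint (slotSet t) (slotSet t'))
    (hJo : ∀ t ∈ J, Disjoint (slotSet t) (E₀ ∪ X₁ ∪ C))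
    (hfill : ∀ X, Disjoint X (E₀ ∪ F) → X₁ ⊆ X → J.card ≤ X.card →
      ∃ w : V × V × V → V, Set.InjOn w J ∧ ∀ t ∈ J, w t ∈ X ∧ G.Adj (w t) t.1 ∧ G.Adj (w t) t.2.1)
    (hnum₁ : X₁.card + C.card + u₀ + 2 * m ≤ J.card)
    (hnum₂ : J.card + F.card ≤ Fintype.card β)
    (s : β → ℕ) (next : β → β) (hnext : Function.Injective next) (hs : ∀ b, 3 ≤ s b)
    (hself : ∀ b, s b < 5 → next b = b) (hsum : ∑ b, s b + E₀.card = Fintype.card V) :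
    ∃ P, IsBlockFamily G s next E₀ P := by
  obtain ⟨I, -, hI⟩ := exists_subset_card_eq (s := (univ : Finset β)) (n := J.card)
    (by rw [card_univ]; omega)
  obtain ⟨σ, hσ, hσJ⟩ := exists_injOn_of_card_le I J hI.le
  have hkey : ∀ b ∈ I, ∀ b' ∈ I, ∀ v, v ∈ slotSet (σ b) → v ∈ slotSet (σ b') → b = b' := by
    intro b hb b' hb' v hv hv'
    by_contra hne
    exact disjoint_left.mp (hJd _ (hσJ b hb) _ (hσJ b' hb') fun h => hne (hσ hb hb' h)) hv hv'
  set x : β → V := fun b => (σ b).1 with hx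
  set y : β → V := fun b => (σ b).2.1 with hy
  set z : β → V := fun b => (σ b).2.2 with hz
  have hxm : ∀ b, x b ∈ slotSet (σ b) := fun b => by simp [slotSet, hx]
  have hym : ∀ b, y b ∈ slotSet (σ b) := fun b => by simp [slotSet, hy]
  have hzm : ∀ b, z b ∈ slotSet (σ b) := fun b => by simp [slotSet, hz]
  have hxyz : ∀ b ∈ I, G.Adj (x b) (y b) ∧ G.Adj (y b) (z b) ∧ G.Adj (z b) (x b) :=
    fun b hb => hadj _ (hσJ b hb)
  have hxinj : ∀ b ∈ I, ∀ b' ∈ I, x b = x b' → b = b' := fun b hb b' hb' h =>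
    hkey b hb b' hb' _ (hxm b) (h ▸ hxm b')
  have hyinj : ∀ b ∈ I, ∀ b' ∈ I, y b = y b' → b = b' := fun b hb b' hb' h =>
    hkey b hb b' hb' _ (hym b) (h ▸ hym b')
  have hzinj : ∀ b ∈ I, ∀ b' ∈ I, z b = z b' → b = b' := fun b hb b' hb' h =>
    hkey b hb b' hb' _ (hzm b) (h ▸ hzm b')
  have hxy : ∀ b ∈ I, ∀ b' ∈ I, x b ≠ y b' := fun b hb b' hb' h => by
    have := hkey b hb b' hb' _ (hxm b) (h ▸ hym b')
    subst this
    exact (hxyz b hb).1.ne h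
  have hyz : ∀ b ∈ I, ∀ b' ∈ I, y b ≠ z b' := fun b hb b' hb' h => by
    have := hkey b hb b' hb' _ (hym b) (h ▸ hzm b')
    subst this
    exact (hxyz b hb).2.1.ne h
  have hzx : ∀ b ∈ I, ∀ b' ∈ I, z b ≠ x b' := fun b hb b' hb' h => by
    have := hkey b hb b' hb' _ (hzm b) (h ▸ hxm b')
    subst this
    exact (hxyz b hb).2.2.ne h
  have hslot : ∀ b ∈ I, ∀ v ∈ slotSet (σ b), v ∉ E₀ ∧ v ∉ X₁ ∧ v ∉ C := fun b hb v hv => by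
    have := disjoint_left.mp (hJo _ (hσJ b hb)) hv
    simpa only [mem_union, not_or, and_assoc] using this
  clear_value x y z
  set I' := univ \ I with hI'
  have hmem' : ∀ b, b ∉ I' ↔ b ∈ I := fun b => by simp [hI']
  have hI'card : I'.card + I.card = Fintype.card β := by
    rw [hI', ← card_univ, card_sdiff_add_card_eq_card (subset_univ _)]
  set I₄ := I.filter fun b => s b = 4 with hI₄
  set SE := I.image x ∪ I.image y with hSE
  set ZU := I₄.image z with hZU
  set B := E₀ ∪ X₁ ∪ SE ∪ ZU with hB
  have hSEcard : SE.card ≤ 2 * I.card := by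
    have h1 := card_union_le (I.image x) (I.image y)
    have h2 : (I.image x).card ≤ _ := card_image_le
    have h3 : (I.image y).card ≤ _ := card_image_le
    rw [← hSE] at h1
    omega
  have hZUcard : ZU.card ≤ I₄.card := card_image_le
  have hBcard : B.card ≤ E₀.card + X₁.card + 2 * I.card + I₄.card := by
    have h1 := card_union_le (E₀ ∪ X₁ ∪ SE) ZU
    have h2 := card_union_le (E₀ ∪ X₁) SE
    have h3 := card_union_le E₀ X₁
    rw [← hB] at h1
    omega
  have hxB : ∀ b ∈ I, x b ∈ SE := fun b hb => mem_union_left _ (mem_image_of_mem _ hb)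
  have hyB : ∀ b ∈ I, y b ∈ SE := fun b hb => mem_union_right _ (mem_image_of_mem _ hb)
  have hSEB : SE ⊆ B := fun v hv => mem_union_left _ (mem_union_right _ hv)
  have hZUB : ZU ⊆ B := subset_union_right
  have hSEslot : ∀ v ∈ SE, ∃ b ∈ I, v = x b ∨ v = y b := by
    intro v hv
    rcases mem_union.mp hv with h | h <;> obtain ⟨b, hb, rfl⟩ := mem_image.mp h
    exacts [⟨b, hb, Or.inl rfl⟩, ⟨b, hb, Or.inr rfl⟩]
  have hSE' : ∀ v ∈ SE, v ∉ E₀ ∧ v ∉ X₁ ∧ v ∉ C := by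
    intro v hv
    obtain ⟨b, hb, rfl | rfl⟩ := hSEslot v hv
    exacts [hslot b hb _ (hxm b), hslot b hb _ (hym b)]
  have hZU' : ∀ v ∈ ZU, v ∉ E₀ ∧ v ∉ X₁ ∧ v ∉ C ∧ v ∉ SE := by
    intro v hv
    obtain ⟨b, hb, rfl⟩ := mem_image.mp hv
    have hb' := (mem_filter.mp hb).1
    obtain ⟨h1, h2, h3⟩ := hslot b hb' _ (hzm b)
    refine ⟨h1, h2, h3, fun h => ?_⟩
    obtain ⟨b', hb'', h | h⟩ := hSEslot _ h
    exacts [hzx b hb' b' hb'' h, hyz b' hb'' b hb' h.symm]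
  set g : β → ℕ := fun b => if b ∈ I then s b - 3 else s b - 1 with hg
  set T := univ.filter fun b => 2 ≤ g b with hT
  have hcount : 3 * I.card + I'.card + I₄.card + ∑ b ∈ T, g b ≤ ∑ b, s b := by
    have h1 : ∑ b, ((if b ∈ I then 3 else 0) + (if b ∈ I' then 1 else 0) +
        (if b ∈ I₄ then 1 else 0) + (if b ∈ T then g b else 0)) ≤ ∑ b, s b := by
      refine sum_le_sum fun b _ => ?_
      have h3 := hs b
      have h4 : b ∈ I₄ ↔ b ∈ I ∧ s b = 4 := by rw [hI₄, mem_filter]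
      have h5 : b ∈ T ↔ 2 ≤ g b := by rw [hT, mem_filter]; simp
      by_cases hb : b ∈ I
      · have h6 : g b = s b - 3 := if_pos hb
        have h7 : b ∉ I' := fun h => (hmem' b).mpr hb h
        simp only [if_pos hb, if_neg h7]
        by_cases h8 : s b = 4
        · rw [if_pos (h4.mpr ⟨hb, h8⟩), if_neg (by rw [h5]; omega)]; omega
        · rw [if_neg fun h => h8 (h4.mp h).2]
          split_ifs <;> omega
      · have h6 : g b = s b - 1 := if_neg hb
        have h7 : b ∈ I' := by by_contra h; exact hb ((hmem' b).mp h)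
        rw [if_neg hb, if_pos h7, if_neg fun h => hb (h4.mp h).1]
        split_ifs <;> omega
    simp only [sum_add_distrib, sum_ite_mem, univ_inter, sum_const, smul_eq_mul] at h1
    omega
  have hFB : F \ B ⊆ univ \ (B ∪ (C \ F)) := by
    intro v hv
    simp only [mem_sdiff, mem_univ, true_and, mem_union, not_or, not_and_or, not_not] at hv ⊢
    tauto
  obtain ⟨A, hFA, hA, hAcard⟩ := exists_subsuperset_card_eq hFB (n := I'.card)
    ((card_le_card sdiff_subset).trans (by omega)) (by
      have h1 := le_card_sdiff (B ∪ (C \ F)) univ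
      have h2 := card_union_le B (C \ F)
      have h3 := card_le_card (sdiff_subset : C \ F ⊆ C)
      rw [card_univ] at h1
      omega)
  have hAB : ∀ v ∈ A, v ∉ B ∧ (v ∈ C → v ∈ F) := by
    intro v hv
    have := hA hv
    simp only [mem_sdiff, mem_univ, true_and, mem_union, not_or, not_and_or, not_not] at this
    tauto
  obtain ⟨f₀, hf₀inj, hf₀A⟩ := exists_injOn_of_card_le I' A hAcard.ge
  have hf₀surj : I'.image f₀ = A := eq_of_subset_of_card_le
    (image_subset_iff.mpr hf₀A) (by rw [card_image_of_injOn hf₀inj, hAcard])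
  set R₀ := univ \ (B ∪ A ∪ C) with hR₀
  have hR₀' : ∀ v ∈ R₀, v ∉ B ∧ v ∉ A ∧ v ∉ C := by
    intro v hv
    simpa only [hR₀, mem_sdiff, mem_univ, true_and, mem_union, not_or, and_assoc] using hv
  have hR₀card : u₀ + 2 * m + ∑ b ∈ T, g b ≤ R₀.card := by
    have h1 := le_card_sdiff (B ∪ A ∪ C) univ
    have h2 := card_union_le B A
    have h3 := card_union_le (B ∪ A) C
    rw [card_univ, ← hR₀] at h1
    omega
  have hinj₀ : ∀ e : β → V, (∀ b ∈ I, e b ∈ SE) → (∀ b ∈ I, ∀ b' ∈ I, e b = e b' → b = b') →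
      Function.Injective fun b => if b ∈ I' then f₀ b else e b := by
    intro e he he' a b hab
    have key : ∀ a ∈ I', ∀ b ∉ I', f₀ a ≠ e b := fun a ha b hb h =>
      (hAB _ (hf₀A a ha)).1 (h ▸ hSEB (he b ((hmem' b).mp hb)))
    by_cases ha : a ∈ I' <;> by_cases hb : b ∈ I'
    · simp only [if_pos ha, if_pos hb] at hab
      exact hf₀inj ha hb hab
    · simp only [if_pos ha, if_neg hb] at hab
      exact absurd hab (key a ha b hb)
    · simp only [if_neg ha, if_pos hb] at hab
      exact absurd hab.symm (key b hb a ha)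
    · simp only [if_neg ha, if_neg hb] at hab
      exact he' a ((hmem' a).mp ha) b ((hmem' b).mp hb) hab
  obtain ⟨f, c₁, hfinj, hc₁, hc₁U, hfU, hff⟩ := exists_conn_moving hE hLow hm C F R₀ hS hC next
    hnext g I' y x f₀ (hinj₀ y hyB hyinj) (hinj₀ x hxB hxinj) T (fun b hb => (mem_filter.mp hb).2)
    (disjoint_left.mpr fun v hv => (hR₀' v hv).2.2) (fun b hb h => (hR₀' _ h).2.1 (hf₀A b hb))
    (fun b hb => (hAB _ (hf₀A b hb)).2)
    (fun b hb h => (hR₀' _ h).1 (hSEB (hyB b ((hmem' b).mp hb))))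
    (fun b hb h => (hR₀' _ h).1 (hSEB (hxB b ((hmem' b).mp hb)))) hR₀card
  set U := listUnion c₁ T with hU
  set out : β → V := fun b => if b ∈ I' then f b else y b with hout
  set inn : β → V := fun b => if b ∈ I' then f b else x b with hinn
  have hfB : ∀ b ∈ I', f b ∉ B := fun b hb => by
    rcases hff b hb with h | ⟨h, -⟩
    · rw [h]; exact (hAB _ (hf₀A b hb)).1
    · exact (hR₀' _ h).1
  have hsmall : ∀ b ∈ univ \ T, b ∈ I ∧ (s b = 3 ∨ s b = 4) ∧ g b = s b - 3 := by
    intro b hb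
    have h1 : g b < 2 := by
      by_contra! h
      exact (mem_sdiff.mp hb).2 (mem_filter.mpr ⟨mem_univ _, h⟩)
    have h2 := hs b
    by_cases hbI : b ∈ I
    · have h3 : g b = s b - 3 := if_pos hbI
      exact ⟨hbI, by omega, h3⟩
    · have h3 : g b = s b - 1 := if_neg hbI
      omega
  set c₀ : β → List V := fun b => if s b = 4 then [z b] else [] with hc₀def
  have hc₀ : IsConn G out (fun b => inn (next b)) g (univ \ T) c₀ :=
    isConn_triangles s g next x y z out inn (univ \ T) (fun b hb => (hsmall b hb).2.1)
      (fun b hb => (hsmall b hb).2.2) (fun b hb => hxyz b (hsmall b hb).1)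
      (fun a ha b hb h => hzinj a (hsmall a ha).1 b (hsmall b hb).1 h)
      (fun b hb => if_neg ((hmem' b).mpr (hsmall b hb).1)) (fun b hb => by
        rw [hself b (by have := (hsmall b hb).2.1; omega)]
        exact if_neg ((hmem' b).mpr (hsmall b hb).1))
  have hc₀U : listUnion c₀ (univ \ T) ⊆ ZU := by
    intro v hv
    obtain ⟨b, hb, hvb⟩ := mem_listUnion.mp hv
    by_cases h4 : s b = 4
    · simp only [hc₀def, if_pos h4, List.mem_singleton] at hvb
      exact mem_image.mpr ⟨b, mem_filter.mpr ⟨(hsmall b hb).1, h4⟩, hvb.symm⟩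
    · simp [hc₀def, h4] at hvb
  have hUB : ∀ v ∈ U, v ∉ E₀ ∧ v ∉ X₁ ∧ v ∉ SE ∧ v ∉ ZU := by
    intro v hv
    rcases mem_union.mp (hc₁U hv) with h | h
    · exact ⟨disjoint_left.mp hCE h, fun h' => disjoint_left.mp hX₁ h'
        (mem_union_left _ (mem_union_right _ h)), fun h' => (hSE' v h').2.2 h,
        fun h' => (hZU' v h').2.2.1 h⟩
    · have := (hR₀' v h).1
      simpa only [hB, mem_union, not_or, and_assoc] using this
  obtain ⟨c, hc, hcU⟩ := hc₁.union hc₀ disjoint_sdiff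
    (disjoint_left.mpr fun v hv hv' => (hUB v hv).2.2.2 (hc₀U hv'))
  rw [union_sdiff_of_subset (subset_univ T)] at hc hcU
  have hcmem : ∀ b, ∀ v ∈ c b, v ∈ U ∨ v ∈ ZU := by
    intro b v hv
    have : v ∈ listUnion c univ := mem_listUnion.mpr ⟨b, mem_univ _, hv⟩
    rw [hcU] at this
    exact (mem_union.mp this).imp id fun h => hc₀U h
  set X := univ \ (E₀ ∪ SE ∪ ZU ∪ I'.image f ∪ U) with hX
  have hX' : ∀ v, v ∈ X ↔ v ∉ E₀ ∧ v ∉ SE ∧ v ∉ ZU ∧ v ∉ I'.image f ∧ v ∉ U := by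
    intro v
    simp only [hX, mem_sdiff, mem_univ, true_and, mem_union, not_or, and_assoc]
  obtain ⟨w, hwinj, hw⟩ := hfill X (by
      rw [disjoint_right]
      intro v hv hvX
      obtain ⟨h1, h2, h3, h4, h5⟩ := (hX' v).mp hvX
      rcases mem_union.mp hv with h | h
      · exact h1 h
      · have hvB : v ∉ B := by
          simp only [hB, mem_union, not_or]
          exact ⟨⟨⟨h1, fun h' => disjoint_left.mp hX₁ h' (mem_union_right _ h)⟩, h2⟩, h3⟩
        have hvA : v ∈ A := hFA (mem_sdiff.mpr ⟨h, hvB⟩)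
        rw [← hf₀surj] at hvA
        obtain ⟨b, hb, rfl⟩ := mem_image.mp hvA
        rcases hff b hb with h' | ⟨-, h'⟩
        · exact h4 (mem_image.mpr ⟨b, hb, h'⟩)
        · exact h5 h') (by
      intro v hv
      refine (hX' v).mpr ⟨fun h => disjoint_left.mp hX₁ hv (mem_union_left _ (mem_union_left _ h)),
        fun h => (hSE' v h).2.1 hv, fun h => (hZU' v h).2.1 hv, fun h => ?_, fun h =>
        (hUB v h).2.1 hv⟩
      obtain ⟨b, hb, rfl⟩ := mem_image.mp h
      exact hfB b hb (mem_union_left _ (mem_union_left _ (mem_union_right _ hv)))) (by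
      have h1 := le_card_sdiff (E₀ ∪ SE ∪ ZU ∪ I'.image f ∪ U) univ
      have h2 := card_union_le (E₀ ∪ SE ∪ ZU ∪ I'.image f) U
      have h3 := card_union_le (E₀ ∪ SE ∪ ZU) (I'.image f)
      have h4 := card_union_le (E₀ ∪ SE) ZU
      have h5 := card_union_le E₀ SE
      have h6 : (I'.image f).card ≤ _ := card_image_le
      have h7 : U.card ≤ _ := hc₁.card_listUnion_le
      rw [card_univ, ← hX] at h1
      omega)
  set pre : β → List V := fun b => if b ∈ I' then [] else [x b, w (σ b)] with hpre
  have hwX : ∀ b ∈ I, w (σ b) ∈ X := fun b hb => (hw _ (hσJ b hb)).1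
  have hwadj : ∀ b ∈ I, G.Adj (x b) (w (σ b)) ∧ G.Adj (w (σ b)) (y b) := fun b hb => by
    have := (hw _ (hσJ b hb)).2
    rw [hx, hy]
    exact ⟨this.1.symm, this.2⟩
  have hpre₁ : ∀ b ∈ I', pre b ++ [out b] = [f b] := fun b hb => by
    simp only [hpre, hout, if_pos hb, List.nil_append]
  have hpre₂ : ∀ b ∈ I, pre b ++ [out b] = [x b, w (σ b), y b] := fun b hb => by
    have := (hmem' b).mpr hb
    simp only [hpre, hout, if_neg this, List.cons_append, List.nil_append]
  have hcases : ∀ b, b ∈ I' ∨ b ∈ I := fun b => by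
    rw [← hmem' b]; exact em _
  have hpmem : ∀ b, ∀ v ∈ pre b ++ [out b], (b ∈ I' ∧ v = f b) ∨ (b ∈ I ∧ v ∈ SE ∧
      (v = x b ∨ v = y b)) ∨ (b ∈ I ∧ v = w (σ b)) := by
    intro b v hv
    rcases hcases b with hb | hb
    · rw [hpre₁ b hb, List.mem_singleton] at hv
      exact Or.inl ⟨hb, hv⟩
    · rw [hpre₂ b hb] at hv
      simp only [List.mem_cons, List.not_mem_nil, or_false] at hv
      rcases hv with rfl | rfl | rfl
      · exact Or.inr (Or.inl ⟨hb, hxB b hb, Or.inl rfl⟩)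
      · exact Or.inr (Or.inr ⟨hb, rfl⟩)
      · exact Or.inr (Or.inl ⟨hb, hyB b hb, Or.inr rfl⟩)
  have hfI : ∀ b ∈ I', f b ∈ I'.image f := fun b hb => mem_image_of_mem _ hb
  have hfE : ∀ b ∈ I', f b ∉ E₀ ∧ f b ∉ SE ∧ f b ∉ ZU := fun b hb => by
    have := hfB b hb
    simp only [hB, mem_union, not_or] at this
    tauto
  refine ⟨_, isBlockFamily_of_conn (g := g) pre out inn c hc ?_ ?_ ?_ ?_ ?_ ?_ ?_ ?_⟩
  · intro b
    have h3 := hs b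
    rcases hcases b with hb | hb
    · have h1 : g b = s b - 1 := if_neg fun h => (hmem' b).mpr h hb
      simp only [hpre, if_pos hb, List.length_nil]
      omega
    · have h1 : g b = s b - 3 := if_pos hb
      have h2 := (hmem' b).mpr hb
      simp only [hpre, if_neg h2, List.length_cons, List.length_nil]
      omega
  · intro b
    rcases hcases b with hb | hb
    · rw [hpre₁ b hb]; simp
    · rw [hpre₂ b hb]; simp [hwadj b hb]
  · intro b
    rcases hcases b with hb | hb
    · rw [hpre₁ b hb]; simp
    · rw [hpre₂ b hb]
      simp [(hwadj b hb).1.ne, (hwadj b hb).2.ne, (hxyz b hb).1.ne]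
  · intro b
    rcases hcases b with hb | hb
    · rw [hpre₁ b hb]; simp [hinn, hb]
    · rw [hpre₂ b hb]; simp [hinn, (hmem' b).mpr hb]
  · intro b b' hne v hv hv'
    rcases hpmem b v hv with ⟨hb, e⟩ | ⟨hb, hvS, e⟩ | ⟨hb, e⟩ <;>
      rcases hpmem b' v hv' with ⟨hb', e'⟩ | ⟨hb', hvS', e'⟩ | ⟨hb', e'⟩
    · exact hne (hfinj hb hb' (e ▸ e'))
    · exact (hfE b hb).2.1 (e ▸ hvS')
    · exact ((hX' _).mp (hwX b' hb')).2.2.2.1 (e' ▸ e ▸ hfI b hb)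
    · exact (hfE b' hb').2.1 (e' ▸ hvS)
    · rcases e with e | e <;> rcases e' with e' | e'
      · exact hne (hxinj b hb b' hb' (e ▸ e'))
      · exact hxy b hb b' hb' (e ▸ e')
      · exact hxy b' hb' b hb (e' ▸ e)
      · exact hne (hyinj b hb b' hb' (e ▸ e'))
    · exact ((hX' _).mp (hwX b' hb')).2.1 (e' ▸ hvS)
    · exact ((hX' _).mp (hwX b hb)).2.2.2.1 (e ▸ e' ▸ hfI b' hb')
    · exact ((hX' _).mp (hwX b hb)).2.1 (e ▸ hvS')
    · exact hne (hσ hb hb' (hwinj (hσJ b hb) (hσJ b' hb') (e ▸ e')))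
  · intro b b' v hv hv'
    have hv'' := hcmem b' v hv'
    rcases hpmem b v hv with ⟨hb, e⟩ | ⟨hb, hvS, e⟩ | ⟨hb, e⟩
    · rcases hv'' with h | h
      · exact hfU b hb (e ▸ h)
      · exact (hfE b hb).2.2 (e ▸ h)
    · rcases hv'' with h | h
      · exact (hUB v h).2.2.1 hvS
      · exact (hZU' v h).2.2.2 hvS
    · have := (hX' _).mp (hwX b hb)
      rw [← e] at this
      tauto
  · intro b v hv
    rcases hpmem b v hv with ⟨hb, e⟩ | ⟨hb, hvS, e⟩ | ⟨hb, e⟩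
    · exact e ▸ (hfE b hb).1
    · exact (hSE' v hvS).1
    · exact e ▸ ((hX' _).mp (hwX b hb)).1
  · intro b v hv
    rcases hcmem b v hv with h | h
    · exact (hUB v h).1
    · exact (hZU' v h).1

end Filling

section Triangles

variable {V : Type} [Fintype V] [DecidableEq V] {G : SimpleGraph V} [DecidableRel G.Adj]

/-- The first vertex of the triangle `t` has many neighbours in `A`, but no common neighbour with
the second one. -/
def Misses (G : SimpleGraph V) [DecidableRel G.Adj] (p : ℝ) (A : Finset V) (t : V × V × V) : Prop :=
  p * A.card / 2 ≤ (nbrIn G t.1 A).card ∧ ∀ a ∈ A, ¬ (G.Adj a t.1 ∧ G.Adj a t.2.1)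

open Classical in
/-- A triangle which increases a weighted count of missed sets only a little. -/
lemma exists_triangle_weight {p lam k M a u : ℝ} (hp : 0 < p) (h : Bijumbled G p lam)
    (hk : lam ≤ p * k) (hk₀ : 0 ≤ k) (hM : 1 ≤ M) (ha : 0 < a) (U : Finset V) (hU : u ≤ U.card)
    (h₁ : 2 * k < u) (h₂ : 8 * k ^ 2 ≤ (p * u) ^ 2)
    (h₃ : M * k ^ 2 ≤ p * a / 2 * (p * u / 4)) (𝒜 : Finset (Finset V))
    (h𝒜 : ∀ A ∈ 𝒜, a ≤ A.card) (wt : Finset V → ℝ) (hwt : ∀ A, 0 ≤ wt A) :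
    ∃ t : V × V × V, slotSet t ⊆ U ∧ G.Adj t.1 t.2.1 ∧ G.Adj t.2.1 t.2.2 ∧ G.Adj t.2.2 t.1 ∧
      ∑ A ∈ 𝒜, wt A * (if Misses G p A t then M else 1) ≤ 2 * ∑ A ∈ 𝒜, wt A := by
  have hu : 0 < u := by linarith
  obtain ⟨x, hxU, hx⟩ : ∃ x ∈ U, p * U.card / 2 < (nbrIn G x U).card := by
    by_contra! hcon
    have := h.low_degree hp hk U U hcon
    nlinarith
  set N := nbrIn G x U with hN
  have hNu : p * u / 2 < N.card := lt_of_le_of_lt (by gcongr) hx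
  have hNpos : (0 : ℝ) < N.card := lt_of_le_of_lt (by positivity) hNu
  set Y := N.filter fun y => ∃ z ∈ N, G.Adj y z with hY
  have hYN : (N.card : ℝ) ≤ 2 * Y.card := by
    have e1 : (((N \ Y).card : ℝ)) * N.card ≤ k ^ 2 := by
      refine h.no_edges hp hk _ _ fun y hy z hz hyz => ?_
      obtain ⟨hy1, hy2⟩ := mem_sdiff.mp hy
      exact hy2 (mem_filter.mpr ⟨hy1, z, hz, hyz⟩)
    have e2 : ((N \ Y).card : ℝ) + Y.card = N.card := by
      exact_mod_cast card_sdiff_add_card_eq_card (filter_subset _ N)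
    have e3 : 2 * k ^ 2 ≤ (N.card : ℝ) ^ 2 := by
      have : (p * u / 2) ^ 2 ≤ (N.card : ℝ) ^ 2 := by gcongr
      nlinarith
    by_contra! hlt
    have e4 : (N.card : ℝ) / 2 < (N \ Y).card := by linarith
    have : (N.card : ℝ) / 2 * N.card < (N \ Y).card * N.card := by gcongr
    nlinarith
  have hYpos : (0 : ℝ) < Y.card := by linarith
  have hmiss : ∀ A ∈ 𝒜, ∑ y ∈ Y, (if Misses G p A (x, y, y) then M else 1) ≤ 2 * (Y.card : ℝ) := by
    intro A hA
    by_cases hxA : p * A.card / 2 ≤ (nbrIn G x A).card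
    · set B := Y.filter fun y => Misses G p A (x, y, y) with hB
      have e1 : (B.card : ℝ) * (nbrIn G x A).card ≤ k ^ 2 := by
        refine h.no_edges hp hk _ _ fun y hy v hv hyv => ?_
        rw [mem_nbrIn] at hv
        exact (mem_filter.mp hy).2.2 v hv.1 ⟨hv.2.symm, hyv.symm⟩
      have e2 : p * a / 2 ≤ (nbrIn G x A).card := le_trans (by have := h𝒜 A hA; gcongr) hxA
      have e3 : (B.card : ℝ) * (p * a / 2) ≤ k ^ 2 := le_trans (by gcongr) e1
      have e4 : M * B.card ≤ Y.card := by
        have e5 : M * ((B.card : ℝ) * (p * a / 2)) ≤ p * a / 2 * (p * u / 4) :=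
          le_trans (by gcongr) h₃
        have e6 : (0 : ℝ) < p * a / 2 := by positivity
        have e7 : M * B.card ≤ p * u / 4 := by
          by_contra! hlt
          have := mul_lt_mul_of_pos_left hlt e6
          linarith
        linarith
      have e5 : ∀ y ∈ Y, (if Misses G p A (x, y, y) then M else 1) ≤
          1 + if Misses G p A (x, y, y) then M else 0 := by
        intro y _
        split_ifs <;> linarith
      refine (sum_le_sum e5).trans ?_
      rw [sum_add_distrib, ← sum_filter, ← hB]
      simp only [sum_const, nsmul_eq_mul]
      linarith
    · rw [sum_congr rfl fun y _ => if_neg fun hm => hxA hm.1]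
      simp only [sum_const, nsmul_eq_mul]
      linarith
  obtain ⟨y, hyY, hy⟩ : ∃ y ∈ Y, ∑ A ∈ 𝒜, wt A * (if Misses G p A (x, y, y) then M else 1) ≤
      2 * ∑ A ∈ 𝒜, wt A := by
    refine exists_le_of_sum_le (card_pos.mp (by exact_mod_cast hYpos)) ?_
    rw [sum_comm, sum_const, nsmul_eq_mul, mul_left_comm, mul_sum, mul_sum]
    refine sum_le_sum fun A hA => ?_
    rw [← mul_sum]
    have := mul_le_mul_of_nonneg_left (hmiss A hA) (hwt A)
    linarith
  obtain ⟨hyN, z, hzN, hyz⟩ := mem_filter.mp hyY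
  rw [mem_nbrIn] at hyN hzN
  refine ⟨(x, y, z), ?_, hyN.2, hyz, hzN.2.symm, hy⟩
  intro v hv
  simp only [slotSet, mem_insert, mem_singleton] at hv
  rcases hv with rfl | rfl | rfl
  exacts [hxU, hyN.1, hzN.1]

open Classical in
lemma exists_triangles_weight {p lam k M : ℝ} (hp : 0 < p) (h : Bijumbled G p lam)
    (hk : lam ≤ p * k) (hk₀ : 0 ≤ k) (hM : 1 ≤ M) (f u N : ℕ) (hf : 0 < f)
    (h₁ : 2 * k < u) (h₂ : 8 * k ^ 2 ≤ (p * u) ^ 2)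
    (h₃ : M * k ^ 2 ≤ p * f / 2 * (p * u / 4)) (P : Finset V) (hP : u + 3 * N ≤ P.card) :
    ∃ J : Finset (V × V × V), J.card = N ∧ (∀ t ∈ J, slotSet t ⊆ P) ∧
      (∀ t ∈ J, G.Adj t.1 t.2.1 ∧ G.Adj t.2.1 t.2.2 ∧ G.Adj t.2.2 t.1) ∧
      (∀ t ∈ J, ∀ t' ∈ J, t ≠ t' → Disjoint (slotSet t) (slotSet t')) ∧
      ∑ A : Finset V with f ≤ A.card, M ^ (J.filter fun t => Misses G p A t).card ≤
        2 ^ N * 2 ^ Fintype.card V := by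
  induction N with
  | zero =>
    refine ⟨∅, by simp, by simp, by simp, by simp, ?_⟩
    simp only [filter_empty, card_empty, pow_zero, sum_const, nsmul_eq_mul, mul_one, one_mul]
    have h1 : (univ.filter fun A : Finset V => f ≤ A.card).card ≤ 2 ^ Fintype.card V := by
      refine (card_le_univ _).trans ?_
      rw [Fintype.card_finset]
    exact_mod_cast h1
  | succ N ih =>
    obtain ⟨J, hJ, hJP, hJadj, hJd, hsum⟩ := ih (by omega)
    have hcard : (J.biUnion slotSet).card ≤ N * 3 := by
      rw [← hJ]
      exact card_biUnion_le_card_mul _ _ _ fun t _ => card_le_three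
    have hU : u ≤ (P \ J.biUnion slotSet).card := by
      have := le_card_sdiff (J.biUnion slotSet) P
      omega
    obtain ⟨t, htU, ht1, ht2, ht3, htsum⟩ := exists_triangle_weight hp h hk hk₀ hM
      (show (0 : ℝ) < f by exact_mod_cast hf) (P \ J.biUnion slotSet)
      (show (u : ℝ) ≤ _ by exact_mod_cast hU) h₁ h₂ h₃ (univ.filter fun A : Finset V => f ≤ A.card)
      (fun A hA => by exact_mod_cast (mem_filter.mp hA).2)
      (fun A => M ^ (J.filter fun t => Misses G p A t).card)
      (fun A => pow_nonneg (by linarith) _)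
    have htd : ∀ t' ∈ J, Disjoint (slotSet t) (slotSet t') := by
      intro t' ht'
      refine disjoint_left.mpr fun v hv hv' => ?_
      exact (mem_sdiff.mp (htU hv)).2 (mem_biUnion.mpr ⟨t', ht', hv'⟩)
    have htJ : t ∉ J := fun htJ =>
      disjoint_left.mp (htd t htJ) (show t.1 ∈ slotSet t by simp [slotSet]) (by simp [slotSet])
    refine ⟨insert t J, by rw [card_insert_of_notMem htJ, hJ], ?_, ?_, ?_, ?_⟩
    · intro t' ht'
      rcases mem_insert.mp ht' with rfl | ht'
      exacts [htU.trans sdiff_subset, hJP t' ht']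
    · intro t' ht'
      rcases mem_insert.mp ht' with rfl | ht'
      exacts [⟨ht1, ht2, ht3⟩, hJadj t' ht']
    · intro a ha b hb hab
      rcases mem_insert.mp ha with rfl | ha' <;> rcases mem_insert.mp hb with rfl | hb'
      exacts [absurd rfl hab, htd b hb', (htd a ha').symm, hJd a ha' b hb' hab]
    · calc _ = ∑ A : Finset V with f ≤ A.card, M ^ (J.filter fun t => Misses G p A t).card *
            (if Misses G p A t then M else 1) := by
            refine sum_congr rfl fun A _ => ?_
            rw [filter_insert]
            split_ifs with hA
            · rw [card_insert_of_notMem fun h' => htJ (mem_filter.mp h').1, pow_succ]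
            · rw [mul_one]
        _ ≤ _ := htsum
        _ ≤ _ := by rw [pow_succ]; linarith

/-- Disjoint triangles such that, for every large set `A`, almost all of them have an edge (formed
by the first two vertices) in a common triangle with a vertex of `A`. -/
theorem exists_triangles {p lam k : ℝ} (hp : 0 < p) (h : Bijumbled G p lam)
    (hk : lam ≤ p * k) (hk₀ : 0 ≤ k) (f u N K : ℕ) (hf : 0 < f)
    (h₁ : 2 * k < u) (h₂ : 8 * k ^ 2 ≤ (p * u) ^ 2)
    (h₃ : 2 ^ K * k ^ 2 ≤ p * f / 2 * (p * u / 4)) (P : Finset V) (hP : u + 3 * N ≤ P.card)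
    (hK : 2 * (N + Fintype.card V) < K * f) (hkf : 8 * k ^ 2 < (f : ℝ) ^ 2) :
    ∃ J : Finset (V × V × V), J.card = N ∧ (∀ t ∈ J, slotSet t ⊆ P) ∧
      (∀ t ∈ J, G.Adj t.1 t.2.1 ∧ G.Adj t.2.1 t.2.2 ∧ G.Adj t.2.2 t.1) ∧
      (∀ t ∈ J, ∀ t' ∈ J, t ≠ t' → Disjoint (slotSet t) (slotSet t')) ∧
      ∀ A : Finset V, f ≤ A.card →
        (J.filter fun t => ∀ a ∈ A, ¬ (G.Adj a t.1 ∧ G.Adj a t.2.1)).card < f := by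
  classical
  obtain ⟨J, hJ, hJP, hJadj, hJd, hsum⟩ := exists_triangles_weight hp h hk hk₀
    (one_le_pow₀ (one_le_two (α := ℝ)) (n := K)) f u N hf h₁ h₂ h₃ P hP
  refine ⟨J, hJ, hJP, hJadj, hJd, fun A hA => ?_⟩
  set m := (J.filter fun t => Misses G p A t).card with hm
  have e1 : 2 * m < f := by
    have h1 : ((2 : ℝ) ^ K) ^ m ≤ 2 ^ N * 2 ^ Fintype.card V :=
      (single_le_sum (f := fun A : Finset V =>
        ((2 : ℝ) ^ K) ^ (J.filter fun t => Misses G p A t).card) (fun A _ => by positivity)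
        (mem_filter.mpr ⟨mem_univ A, hA⟩)).trans hsum
    rw [← pow_mul, ← pow_add] at h1
    have h2 : K * m ≤ N + Fintype.card V := (pow_le_pow_iff_right₀ one_lt_two).mp h1
    by_contra! h3
    have : K * f ≤ K * (2 * m) := Nat.mul_le_mul_left _ h3
    have : K * (2 * m) = 2 * (K * m) := by ring
    omega
  set L := J.filter fun t => ((nbrIn G t.1 A).card : ℝ) ≤ p * A.card / 2 with hL
  have e2 : 2 * L.card < f := by
    have h1 : (L.image Prod.fst).card = L.card := by
      refine card_image_of_injOn fun a ha b hb hab => ?_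
      by_contra hne
      refine disjoint_left.mp (hJd a (mem_filter.mp ha).1 b (mem_filter.mp hb).1 hne)
        (show a.1 ∈ slotSet a by simp [slotSet]) ?_
      rw [hab]; simp [slotSet]
    have h2 := h.low_degree hp hk (L.image Prod.fst) A fun v hv => by
      obtain ⟨t, ht, rfl⟩ := mem_image.mp hv
      exact (mem_filter.mp ht).2
    rw [h1] at h2
    have h3 : (f : ℝ) ≤ A.card := by exact_mod_cast hA
    by_contra! h4
    have h5 : (f : ℝ) ≤ 2 * L.card := by exact_mod_cast h4
    have h6 : (f : ℝ) * f ≤ 2 * L.card * A.card := by gcongr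
    nlinarith
  have e3 : J.filter (fun t => ∀ a ∈ A, ¬ (G.Adj a t.1 ∧ G.Adj a t.2.1)) ⊆
      J.filter (fun t => Misses G p A t) ∪ L := by
    intro t ht
    obtain ⟨ht1, ht2⟩ := mem_filter.mp ht
    rcases le_total (p * A.card / 2) ((nbrIn G t.1 A).card : ℝ) with h' | h'
    · exact mem_union_left _ (mem_filter.mpr ⟨ht1, h', ht2⟩)
    · exact mem_union_right _ (mem_filter.mpr ⟨ht1, h'⟩)
  have e4 := (card_le_card e3).trans (card_union_le _ _)
  omega

end Triangles

section Final

variable {V : Type} [Fintype V] [DecidableEq V] {G : SimpleGraph V} [DecidableRel G.Adj]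

lemma Bijumbled.joinsLarge {p lam k : ℝ} (hp : 0 < p) (h : Bijumbled G p lam) (hk : lam ≤ p * k)
    (hk₀ : 0 ≤ k) {m : ℕ} (hm : k < m) : JoinsLarge G m := by
  intro A B hA hB
  by_contra! hcon
  have h1 := h.no_edges hp hk A B hcon
  have h2 : (m : ℝ) ≤ A.card := by exact_mod_cast hA
  have h3 : (m : ℝ) ≤ B.card := by exact_mod_cast hB
  have h4 : (m : ℝ) * m ≤ A.card * B.card := by gcongr
  nlinarith

lemma Bijumbled.reachesLarge {p lam k : ℝ} (hp : 0 < p) (h : Bijumbled G p lam) (hk : lam ≤ p * k)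
    {u₀ m : ℕ} (hu₀ : 0 < u₀) (h₁ : 8 * m ≤ p * u₀) (h₂ : 64 * k ^ 2 ≤ m * u₀) :
    ReachesLarge G u₀ m := by
  intro U hU
  have hU' : (u₀ : ℝ) ≤ U.card := by exact_mod_cast hU
  have hu₀' : (0 : ℝ) < u₀ := by exact_mod_cast hu₀
  set S := univ.filter fun v => (nbrIn G v U).card < 4 * m with hS
  have h3 := h.low_degree hp hk S U fun a ha => by
    have h4 : ((nbrIn G a U).card : ℝ) < 4 * m := by exact_mod_cast (mem_filter.mp ha).2
    have h5 : p * u₀ ≤ p * U.card := by gcongr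
    linarith
  have h6 : (S.card : ℝ) * u₀ ≤ S.card * U.card := by gcongr
  have h7 : 16 * (S.card : ℝ) * u₀ ≤ m * u₀ := by nlinarith
  have h8 := le_of_mul_le_mul_right h7 hu₀'
  exact_mod_cast h8

lemma Bijumbled.card_highDegree {p lam k : ℝ} (hp : 0 < p) (hp1 : p ≤ 1) (h : Bijumbled G p lam)
    (hk : lam ≤ p * k) (hk₀ : 0 ≤ k) {m : ℕ} (hm : 2 * k < m) (F : Finset V)
    (hF : p * F.card ≤ 10 * m) :
    16 * (univ.filter fun v => 20 * m ≤ (nbrIn G v F).card).card ≤ m := by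
  set S := univ.filter fun v => 20 * m ≤ (nbrIn G v F).card with hS
  have h1 := h.high_degree (d := 20 * m / p) hp hk S F
    (by rw [le_div_iff₀ hp]; linarith) fun a ha => by
      rw [mul_div_cancel₀ _ hp.ne']
      exact_mod_cast (mem_filter.mp ha).2
  have hm0 : (0 : ℝ) < m := by linarith
  rw [div_pow, mul_div_assoc', div_le_iff₀ (by positivity)] at h1
  have h2 : 4 * k ^ 2 * F.card * p ^ 2 ≤ 10 * m ^ 3 := by
    have e1 : 4 * k ^ 2 ≤ (m : ℝ) ^ 2 := by nlinarith
    calc 4 * k ^ 2 * (F.card : ℝ) * p ^ 2 = 4 * k ^ 2 * (p * F.card) * p := by ring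
      _ ≤ (m : ℝ) ^ 2 * (10 * m) * 1 := by gcongr
      _ = _ := by ring
  have h3 : 16 * (S.card : ℝ) * m ^ 2 ≤ m * m ^ 2 := by nlinarith
  have h4 := le_of_mul_le_mul_right h3 (by positivity)
  exact_mod_cast h4

theorem Bijumbled.exists_blockFamily {p lam k : ℝ} (hp : 0 < p) (hp1 : p ≤ 1)
    (h : Bijumbled G p lam) (hk : lam ≤ p * k) (hk₀ : 0 ≤ k) (C₀ : Finset V)
    (m u₀ f u K N N₁ : ℕ) (hC₀ : ∀ v, 40 * m + 2 ≤ (nbrIn G v C₀).card)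
    (hf : 0 < f) (hu₀ : 0 < u₀) (hm : 2 * k < m) (h₁ : 8 * m ≤ p * u₀)
    (h₂ : 64 * k ^ 2 ≤ m * u₀) (h₃ : p * f ≤ 10 * m) (h₄ : 2 * k < u)
    (h₅ : 8 * k ^ 2 ≤ (p * u) ^ 2) (h₆ : 2 ^ K * k ^ 2 ≤ p * f / 2 * (p * u / 4))
    (h₇ : 8 * k ^ 2 < (f : ℝ) ^ 2) (hK : 2 * (N + Fintype.card V) < K * f)
    (hN₁ : 6 * f ≤ N₁) (hN₁u : N₁ ≤ u) (hN : N₁ + C₀.card + u₀ + 2 * m + f ≤ N)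
    (hNV : 9 * (N + f) + 2 ≤ Fintype.card V) (hu : u + 3 * N + 2 + C₀.card ≤ Fintype.card V)
    (E₀ : Finset V) (hE₀ : E₀.card ≤ 2) {β : Type} [Fintype β] [DecidableEq β] (s : β → ℕ)
    (next : β → β) (hnext : Function.Injective next) (hs : ∀ b, 3 ≤ s b) (hs' : ∀ b, s b ≤ 9)
    (hself : ∀ b, s b < 5 → next b = b) (hsum : ∑ b, s b + E₀.card = Fintype.card V) :
    ∃ P, IsBlockFamily G s next E₀ P := by
  have hβ : ∑ b, s b ≤ Fintype.card β * 9 := by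
    have := sum_le_card_nsmul univ s 9 fun b _ => hs' b
    simpa [card_univ] using this
  have hV : Nonempty V := Fintype.card_pos_iff.mp (by omega)
  have hm' : 1 ≤ m := by
    have : (0 : ℝ) < m := by linarith
    exact_mod_cast this
  have hE := h.joinsLarge hp hk hk₀ (m := m) (by linarith)
  have hLow := h.reachesLarge hp hk hu₀ h₁ h₂
  set C := C₀ \ E₀ with hC
  have hCcard : C.card ≤ C₀.card := card_le_card sdiff_subset
  obtain ⟨J, hJ, hJP, hJadj, hJd, hJL⟩ := exists_triangles hp h hk hk₀ f u N K hf h₄ h₅ h₆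
    (univ \ (E₀ ∪ C)) (by
      have h1 := le_card_sdiff (E₀ ∪ C) univ
      have h2 := card_union_le E₀ C
      rw [card_univ] at h1
      omega) hK h₇
  have hJP' : ∀ t ∈ J, ∀ v ∈ slotSet t, v ∉ E₀ ∧ v ∉ C := fun t ht v hv => by
    simpa only [mem_sdiff, mem_univ, true_and, mem_union, not_or] using hJP t ht hv
  obtain ⟨X₁, hX₁, hX₁card⟩ := exists_subset_card_eq
    (s := univ \ (E₀ ∪ C ∪ J.biUnion slotSet)) (n := N₁) (by
      have h1 := le_card_sdiff (E₀ ∪ C ∪ J.biUnion slotSet) univ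
      have h2 := card_union_le (E₀ ∪ C) (J.biUnion slotSet)
      have h3 := card_union_le E₀ C
      have h4 : (J.biUnion slotSet).card ≤ J.card * 3 :=
        card_biUnion_le_card_mul _ _ _ fun t _ => card_le_three
      rw [card_univ] at h1
      omega)
  have hX₁' : ∀ v ∈ X₁, v ∉ E₀ ∧ v ∉ C ∧ v ∉ J.biUnion slotSet := fun v hv => by
    simpa only [mem_sdiff, mem_univ, true_and, mem_union, not_or, and_assoc] using hX₁ hv
  obtain ⟨D, hD, F, hF, hDcard, hFcard, hfill⟩ := exists_robust_filling
    (fun (t : V × V × V) (v : V) => G.Adj v t.1 ∧ G.Adj v t.2.1) J (univ \ E₀) X₁ f (by omega)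
    (by omega) (fun v hv => by simp [(hX₁' v hv).1]) (fun A _ hA => by convert hJL A hA)
  have hJDcard : J.card - D.card ≤ (J \ D).card := le_card_sdiff D J
  have hJDcard' : (J \ D).card ≤ J.card := card_le_card sdiff_subset
  have hXFcard : (X₁ \ F).card ≤ X₁.card := card_le_card sdiff_subset
  have hJDJ : ∀ t ∈ J \ D, t ∈ J := fun t ht => (mem_sdiff.mp ht).1
  refine exists_blockFamily_of_fill hE hLow hm' E₀ C (X₁ \ F) F (J \ D) ?_ ?_ ?_ ?_ ?_ ?_ ?_ ?_ ?_
    ?_ s next hnext hs hself hsum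
  · refine h.card_highDegree hp hp1 hk hk₀ hm F (le_trans ?_ h₃)
    have : (F.card : ℝ) ≤ f := by exact_mod_cast hFcard.le
    gcongr
  · exact fun v => le_card_nbrIn_of_subset (hC₀ v) hE₀ subset_rfl
  · exact sdiff_disjoint
  · rw [disjoint_left]
    intro v hv
    obtain ⟨hv1, hv2⟩ := mem_sdiff.mp hv
    have := hX₁' v hv1
    simp only [mem_union, not_or]
    tauto
  · exact fun t ht => hJadj t (hJDJ t ht)
  · exact fun t ht t' ht' => hJd t (hJDJ t ht) t' (hJDJ t' ht')
  · intro t ht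
    rw [disjoint_left]
    intro v hv
    have h1 := hJP' t (hJDJ t ht) v hv
    have h2 : v ∉ X₁ := fun hvX => (hX₁' v hvX).2.2 (mem_biUnion.mpr ⟨t, hJDJ t ht, hv⟩)
    simp only [mem_union, mem_sdiff, not_or]
    tauto
  · intro X hX hX₁X hcard
    refine hfill X (fun v hv => ?_) hX₁X hcard
    have := disjoint_left.mp hX hv
    simpa only [mem_union, not_or, mem_sdiff, mem_univ, true_and] using this
  · omega
  · omega

end Final

section Constants

variable {V : Type} [Fintype V] [DecidableEq V] {G : SimpleGraph V} [DecidableRel G.Adj]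

lemma Bijumbled.lt_of_nonempty [Nonempty V] {p lam : ℝ} (hp : 0 < p) (h : Bijumbled G p lam) :
    p < lam := by
  obtain ⟨v⟩ := ‹Nonempty V›
  have h1 := h {v} {v} (singleton_nonempty v) (singleton_nonempty v)
  have h2 : ePairs G {v} {v} = 0 := by simp [ePairs]
  simpa [h2, abs_of_pos hp] using h1

lemma mul_exp_neg_lt_one {x t : ℝ} (hx : 1000 < x) (ht : 2 * Real.log x ≤ t) :
    x * 1000 * Real.exp (-t) < 1 := by
  have hx0 : 0 < x := by linarith
  have h1 : Real.exp (-t) ≤ (x * x)⁻¹ := by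
    calc Real.exp (-t) ≤ Real.exp (-(Real.log x + Real.log x)) := Real.exp_le_exp.mpr (by linarith)
      _ = (x * x)⁻¹ := by rw [Real.exp_neg, Real.exp_add, Real.exp_log hx0]
  calc x * 1000 * Real.exp (-t) ≤ x * 1000 * (x * x)⁻¹ := by gcongr
    _ = 1000 / x := by field_simp
    _ < 1 := by rwa [div_lt_one hx0]

theorem Bijumbled.exists_cycleFamily {p lam δ θ ε : ℝ} {K : ℕ} (hp : 0 < p) (hp1 : p ≤ 1)
    (h : Bijumbled G p lam) (hθ : 0 < θ) (hθ1 : 10 ^ 6 * θ ≤ 1) (hθδ : 10 ^ 6 * θ ≤ δ)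
    (hK : 5 ≤ K * θ) (hε : 2 ^ K * ε = θ / 100) (hn : 10 ^ 9 ≤ θ * Fintype.card V)
    (hlam : lam ≤ ε * p ^ 2 * Fintype.card V / Real.log (Fintype.card V))
    (hdeg : ∀ v, δ * p * Fintype.card V ≤ (G.degree v : ℝ)) (E₀ : Finset V) (hE₀ : E₀.card ≤ 2)
    (ι : Type) [Fintype ι] [DecidableEq ι] (ℓ : ι → ℕ) (hℓ : ∀ i, 3 ≤ ℓ i)
    (hsum : ∑ i, ℓ i + E₀.card = Fintype.card V) : ∃ c, IsCycleFamily G ℓ E₀ c := by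
  set n := Fintype.card V with hndef
  have hn15 : (10 : ℝ) ^ 15 ≤ n := by nlinarith
  have hn0 : (0 : ℝ) < n := by linarith
  have hnN : 10 ^ 15 ≤ n := by exact_mod_cast hn15
  have hV : Nonempty V := Fintype.card_pos_iff.mp (by omega)
  have hε0 : 0 < ε := by
    have : 0 < 2 ^ K * ε := by rw [hε]; positivity
    exact pos_of_mul_pos_right this (by positivity)
  have hεθ : 100 * ε ≤ θ := by
    have : 1 * ε ≤ 2 ^ K * ε := by
      gcongr
      exact one_le_pow₀ one_le_two
    linarith
  have hlog : 1 ≤ Real.log n := by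
    rw [Real.le_log_iff_exp_le hn0]
    have := Real.exp_one_lt_d9
    linarith
  have hpn : Real.log n < ε * (p * n) := by
    have h1 := (h.lt_of_nonempty hp).trans_le hlam
    rw [lt_div_iff₀ (by linarith)] at h1
    have h2 : p * Real.log n < p * (ε * (p * n)) := by linarith
    exact lt_of_mul_lt_mul_left h2 hp.le
  set T := p * n with hT
  have hT0 : 0 < T := by positivity
  have hTn : T ≤ n := by nlinarith
  have hk : lam ≤ p * (ε * T) := by
    refine hlam.trans ((div_le_self (by positivity) hlog).trans (le_of_eq ?_))
    rw [hT]; ring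
  have hθT : 100 * Real.log n ≤ θ * T := by
    have := mul_le_mul_of_nonneg_right hεθ hT0.le
    linarith
  have hδT : 10 ^ 6 * (θ * T) ≤ δ * T := by
    have := mul_le_mul_of_nonneg_right hθδ hT0.le
    linarith
  have hdT : ∀ v, δ * T ≤ (G.degree v : ℝ) := fun v => by
    have := hdeg v
    rwa [mul_assoc] at this
  obtain ⟨C, hCcard, hC⟩ := exists_reserve G 1000 (by norm_num) (δ * T) hdT (by
    push_cast
    exact mul_exp_neg_lt_one (by linarith) (by linarith))
  obtain ⟨m, hm⟩ : ∃ m : ℕ, m = ⌈θ * T⌉₊ := ⟨_, rfl⟩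
  obtain ⟨u₀, hu₀⟩ : ∃ u₀ : ℕ, u₀ = ⌈(n : ℝ) / 10 ^ 4⌉₊ := ⟨_, rfl⟩
  obtain ⟨f, hf⟩ : ∃ f : ℕ, f = ⌊θ * n⌋₊ := ⟨_, rfl⟩
  have hm₁ : θ * T ≤ m := hm ▸ Nat.le_ceil _
  have hm₂ : (m : ℝ) < θ * T + 1 := hm ▸ Nat.ceil_lt_add_one (by positivity)
  have hu₁ : (n : ℝ) / 10 ^ 4 ≤ u₀ := hu₀ ▸ Nat.le_ceil _
  have hu₂ : (u₀ : ℝ) < n / 10 ^ 4 + 1 := hu₀ ▸ Nat.ceil_lt_add_one (by positivity)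
  have hf₁ : (f : ℝ) ≤ θ * n := hf ▸ Nat.floor_le (by positivity)
  have hf₂ : θ * n < f + 1 := hf ▸ Nat.lt_floor_add_one _
  have hf₃ : 9 / 10 * (θ * n) ≤ f := by linarith
  have hθTn : θ * T ≤ θ * n := by gcongr
  have hθn : 10 ^ 6 * (θ * n) ≤ n := by
    have := mul_le_mul_of_nonneg_right hθ1 hn0.le
    linarith
  have hmN : 500000 * m ≤ n := by
    have : 500000 * (m : ℝ) ≤ n := by linarith
    exact_mod_cast this
  have huN : 5000 * u₀ ≤ n := by
    have : 5000 * (u₀ : ℝ) ≤ n := by linarith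
    exact_mod_cast this
  have hfN : 10 ^ 6 * f ≤ n := by
    have : 10 ^ 6 * (f : ℝ) ≤ n := by linarith
    exact_mod_cast this
  have hf0 : 0 < f := by
    have : (0 : ℝ) < f := by linarith
    exact_mod_cast this
  have hu0 : 0 < u₀ := by
    have : (0 : ℝ) < u₀ := by linarith
    exact_mod_cast this
  have hCm : ∀ v, 40 * m + 2 ≤ (nbrIn G v C).card := fun v => by
    have h1 := hC v
    push_cast at h1
    have : 40 * (m : ℝ) + 2 ≤ (nbrIn G v C).card := by linarith
    exact_mod_cast this
  have hu : (n : ℝ) / 4 ≤ ((n / 2 : ℕ) : ℝ) := by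
    have h1 : n ≤ 4 * (n / 2) := by omega
    have h2 : (n : ℝ) ≤ 4 * ((n / 2 : ℕ) : ℝ) := by exact_mod_cast h1
    linarith
  have hεT : ε * T ≤ θ * T / 100 := by
    have := mul_le_mul_of_nonneg_right hεθ hT0.le
    linarith
  have hεT0 : 0 ≤ ε * T := by positivity
  have hsq : (ε * T) ^ 2 ≤ (θ * T / 100) ^ 2 := by gcongr
  have hpu : T / 4 ≤ p * ((n / 2 : ℕ) : ℝ) := by
    have := mul_le_mul_of_nonneg_left hu hp.le
    linarith
  have hpf : 9 / 10 * (θ * T) ≤ p * f := by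
    have := mul_le_mul_of_nonneg_left hf₃ hp.le
    linarith
  refine exists_cycleFamily_of_blocks G E₀ (fun β _ _ s next hnext hs hs' hself hβ =>
    h.exists_blockFamily hp hp1 hk hεT0 C m u₀ f (n / 2) K (n / 100) (n / 1000) hCm hf0 hu0 ?_ ?_ ?_
      ?_ ?_ ?_ ?_ ?_ ?_ ?_ ?_ ?_ ?_ ?_ E₀ hE₀ s next hnext hs hs' hself hβ) ι ℓ hℓ hsum
  · linarith
  · have h1 := mul_le_mul_of_nonneg_left hu₁ hp.le
    have h2 := mul_le_mul_of_nonneg_right hθ1 hT0.le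
    linarith
  · have h1 : θ * T * (n / 10 ^ 4) ≤ m * u₀ := by gcongr
    have h2 : (θ * T) * (θ * T) ≤ θ * T * (n / 10 ^ 6) := by
      gcongr
      linarith
    have h3 : 0 ≤ θ * T * n := by positivity
    linarith
  · have h1 := mul_le_mul_of_nonneg_left hf₁ hp.le
    have h2 : p * (θ * n) = θ * T := by rw [hT]; ring
    linarith
  · have h1 := mul_le_mul_of_nonneg_right hθ1 hT0.le
    linarith
  · have h1 : (T / 4) ^ 2 ≤ (p * ((n / 2 : ℕ) : ℝ)) ^ 2 := by gcongr
    have h2 : (θ * T / 100) ^ 2 ≤ (T / 100) ^ 2 := by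
      gcongr
      exact mul_le_of_le_one_left hT0.le (by linarith)
    have h3 : 0 ≤ T ^ 2 := by positivity
    linarith
  · calc 2 ^ K * (ε * T) ^ 2 = (2 ^ K * ε) * T * (ε * T) := by ring
      _ = θ / 100 * T * (ε * T) := by rw [hε]
      _ ≤ θ / 100 * T * (T / 100) := by
        gcongr
        have := mul_le_mul_of_nonneg_right (show θ ≤ 1 by linarith) hT0.le
        linarith
      _ ≤ 9 / 10 * (θ * T) / 2 * (T / 4 / 4) := by
        have : 0 < θ * T * T := by positivity
        linarith
      _ ≤ p * f / 2 * (p * ((n / 2 : ℕ) : ℝ) / 4) := by gcongr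
  · have h1 : (θ * T / 100) ^ 2 ≤ (θ * n / 100) ^ 2 := by gcongr
    have h2 : (9 / 10 * (θ * n)) ^ 2 ≤ (f : ℝ) ^ 2 := by gcongr
    have h3 : 0 < (θ * n) ^ 2 := by positivity
    linarith
  · have h1 : (K : ℝ) * (9 / 10 * (θ * n)) ≤ K * f := by gcongr
    have h2 : 5 * (n : ℝ) ≤ K * θ * n := by gcongr
    have h3 : 4 * (n : ℝ) ≤ K * f := by linarith
    have h4 : 4 * n ≤ K * f := by exact_mod_cast h3
    omega
  · omega
  · omega
  · omega
  · omega
  · omega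

end Constants

/-- for every `δ > 0` there are `ε > 0` and `n₀` such that every
`(p,λ)`-bijumbled graph `G` on `n ≥ n₀` vertices (`p ∈ (0,1]`) with
`λ ≤ ε p² n / log n` and minimum degree at least `δ p n` is 2-universal: it contains a
copy of every graph `H` on at most `n` vertices with maximum degree at most 2. -/
theorem stmt1 (δ : ℝ) (hδ : 0 < δ) :
    ∃ ε : ℝ, 0 < ε ∧ ∃ n₀ : ℕ, ∀ p : ℝ, 0 < p → p ≤ 1 → ∀ n : ℕ, n₀ ≤ n →
    ∀ (V : Type) [Fintype V] [DecidableEq V] (G : SimpleGraph V) [DecidableRel G.Adj],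
      Fintype.card V = n →
      ∀ lam : ℝ, lam ≤ ε * p ^ 2 * n / Real.log n → Bijumbled G p lam →
      (∀ v : V, δ * p * n ≤ (G.degree v : ℝ)) →
      ∀ (W : Type) [Fintype W] [DecidableEq W] (H : SimpleGraph W) [DecidableRel H.Adj],
        Fintype.card W ≤ n → (∀ w : W, H.degree w ≤ 2) →
        ∃ φ : W → V, Function.Injective φ ∧ ∀ u v : W, H.Adj u v → G.Adj (φ u) (φ v) := by
  obtain ⟨θ, hθ, hθ1, hθδ⟩ : ∃ θ : ℝ, 0 < θ ∧ 10 ^ 6 * θ ≤ 1 ∧ 10 ^ 6 * θ ≤ δ := by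
    refine ⟨min δ 1 / 10 ^ 6, by positivity, ?_, ?_⟩ <;>
      linarith [min_le_left δ 1, min_le_right δ 1]
  obtain ⟨K, hK⟩ := exists_nat_ge (5 / θ)
  rw [div_le_iff₀ hθ] at hK
  obtain ⟨n₀, hn₀⟩ := exists_nat_ge (10 ^ 9 / θ)
  rw [div_le_iff₀ hθ] at hn₀
  refine ⟨θ / 100 / 2 ^ K, by positivity, n₀, ?_⟩
  rintro p hp hp1 n hn V _ _ G _ rfl lam hlam h hdeg W _ _ H _ hW hH
  have hn' : 10 ^ 9 ≤ θ * Fintype.card V := by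
    have h1 : (n₀ : ℝ) ≤ Fintype.card V := by exact_mod_cast hn
    nlinarith
  have hpos : (0 : ℝ) < Fintype.card V := by
    by_contra! hcon
    nlinarith
  obtain ⟨v⟩ : Nonempty V := Fintype.card_pos_iff.mp (by exact_mod_cast hpos)
  refine exists_copy_of_cycles G ?_ (fun ι _ _ ℓ E₀ hE₀ hℓ hsum =>
    h.exists_cycleFamily hp hp1 hθ hθ1 hθδ hK (mul_div_cancel₀ _ (by positivity)) hn' hlam hdeg E₀
      hE₀ ι ℓ hℓ hsum) H hW hH
  have h1 : 0 < G.degree v := by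
    have h2 : 0 < δ * p * Fintype.card V := by positivity
    exact_mod_cast h2.trans_le (hdeg v)
  obtain ⟨w, hw⟩ := (G.degree_pos_iff_exists_adj v).mp h1
  exact ⟨v, w, hw⟩
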